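/- arXiv:2501.00109 — 3 statements merged into one kernel-verified Lean document; each statement's English description precedes it below -/
import Mathlib

section
/- The map x ↦ ζ_x is continuous on (0,∞) and satisfies lim_{x→0⁺} ζ_x = 1/(8π) and lim_{x→∞} ζ_x = −∞. Moreover, there exists a unique x₀ ∈ (0,∞) such that ζ_{x₀} = 0, and ζ_x ≠ 0 for all x ≠ x₀. -/
open Real Set Filter MeasureTheory

/-- The function `y ↦ π/(√(y²−1) − arccos(1/y))`, a strictly decreasing bijection
from `(1,∞)` onto `(0,∞)`. -/
noncomputable def sigmaF (y : ℝ) : ℝ :=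
  Real.pi / (Real.sqrt (y^2 - 1) - Real.arccos (1/y))

/-- `g(t) = arccos(1/t) / √(1 − 1/t²)`. -/
noncomputable def gFun (t : ℝ) : ℝ := Real.arccos (1/t) / Real.sqrt (1 - 1/t^2)

/-- The modified Bessel function of the second kind,
`K_ν(x) = ∫₀^∞ exp(−x cosh t) cosh(ν t) dt`. -/
noncomputable def besselK (ν x : ℝ) : ℝ :=
  ∫ t in Set.Ioi (0:ℝ), Real.exp (-x * Real.cosh t) * Real.cosh (ν * t)

/-- `Θ₀(t) = −(π/(8t²))·g''(f(t))·f(t)/√(f(t)²−1)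
       + (√(f(t)²−1)/(6π t² f(t)³))·∫₀^∞ s³ K₁(s) e^{−s/f(t)} ds`,
where `f` is the inverse of `sigmaF`. -/
noncomputable def theta0 (f : ℝ → ℝ) (t : ℝ) : ℝ :=
  -(Real.pi/(8*t^2)) * deriv (deriv gFun) (f t) * f t / Real.sqrt ((f t)^2 - 1)
    + (Real.sqrt ((f t)^2 - 1) / (6*Real.pi*t^2*(f t)^3))
      * ∫ s in Set.Ioi (0:ℝ), s^3 * besselK 1 s * Real.exp (-s / f t)

/-- `ζ_x = (π/4)·(f(x)/√(f(x)²−1))·(1/(2π²) − ∫₀ˣ Θ₀(t) dt)`. -/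
noncomputable def zetaC (f : ℝ → ℝ) (x : ℝ) : ℝ :=
  (Real.pi/4) * (f x / Real.sqrt ((f x)^2 - 1))
    * (1/(2*Real.pi^2) - ∫ t in (0:ℝ)..x, theta0 f t)

lemma aux_moment (n : ℕ) (r : ℝ) (hr : 0 < r) :
    IntegrableOn (fun s : ℝ => s^n * Real.exp (-(r*s))) (Ioi 0) ∧
    ∫ s in Ioi (0:ℝ), s^n * Real.exp (-(r*s)) = (n.factorial : ℝ) / r^(n+1) := by
  constructor
  · have h := integrableOn_rpow_mul_exp_neg_mul_rpow (p := 1) (s := (n:ℝ)) (b := r)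
      (by have : (0:ℝ) ≤ n := Nat.cast_nonneg n
          linarith) (by norm_num) hr
    refine h.congr_fun ?_ measurableSet_Ioi
    intro s hs
    simp [Real.rpow_natCast]
  · have h := Real.integral_rpow_mul_exp_neg_mul_Ioi (a := (n:ℝ)+1) (r := r) (by positivity) hr
    rw [Real.Gamma_nat_eq_factorial] at h
    simp only [add_sub_cancel_right, Real.rpow_natCast] at h
    rw [h, show ((n:ℝ)+1) = ((n+1 : ℕ) : ℝ) by push_cast; ring, Real.rpow_natCast]
    rw [one_div, inv_pow]; field_simp

lemma aux_sinh (s : ℝ) (hs : 0 < s) :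
    IntegrableOn (fun t : ℝ => Real.exp (-s * Real.cosh t) * Real.sinh t) (Ioi 0) ∧
    ∫ t in Ioi (0:ℝ), Real.exp (-s * Real.cosh t) * Real.sinh t = Real.exp (-s) / s := by
  have hd : ∀ x ∈ Ici (0:ℝ), HasDerivAt (fun t : ℝ => -(Real.exp (-s * Real.cosh t)) / s)
      (Real.exp (-s * Real.cosh x) * Real.sinh x) x := by
    intro x _
    have h := (((Real.hasDerivAt_cosh x).const_mul (-s)).exp.neg).div_const s
    refine h.congr_deriv ?_
    field_simp
  have hn : ∀ x ∈ Ioi (0:ℝ), 0 ≤ Real.exp (-s * Real.cosh x) * Real.sinh x := by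
    intro x hx
    have := Real.sinh_pos_iff.2 hx
    positivity
  have hl : Tendsto (fun t : ℝ => -(Real.exp (-s * Real.cosh t)) / s) atTop (nhds 0) := by
    have h1 : Tendsto Real.cosh atTop atTop := by
      refine tendsto_atTop_mono (f := fun x => x) ?_ tendsto_id
      intro x
      rcases le_total 0 x with h | h
      · exact (Real.self_le_sinh_iff.2 h).trans (Real.sinh_lt_cosh x).le
      · exact h.trans (Real.cosh_pos x).le
    have h2 := Real.tendsto_exp_atBot.comp (h1.const_mul_atTop_of_neg (neg_lt_zero.2 hs))
    simpa using (h2.neg).div_const s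
  refine ⟨integrableOn_Ioi_deriv_of_nonneg' hd hn hl, ?_⟩
  rw [integral_Ioi_of_hasDerivAt_of_nonneg' hd hn hl]
  simp; ring

lemma aux_expint (s : ℝ) (hs : 0 < s) :
    IntegrableOn (fun t : ℝ => Real.exp (-s * Real.cosh t) * Real.exp (-t)) (Ioi 0) ∧
    0 ≤ ∫ t in Ioi (0:ℝ), Real.exp (-s * Real.cosh t) * Real.exp (-t) ∧
    ∫ t in Ioi (0:ℝ), Real.exp (-s * Real.cosh t) * Real.exp (-t) ≤ Real.exp (-s) := by
  have hb : ∀ t : ℝ, Real.exp (-s * Real.cosh t) * Real.exp (-t) ≤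
      Real.exp (-s) * Real.exp (-t) := by
    intro t
    have : Real.exp (-s * Real.cosh t) ≤ Real.exp (-s) := by
      apply Real.exp_le_exp.2
      nlinarith [Real.one_le_cosh t]
    gcongr
  have hi : IntegrableOn (fun t : ℝ => Real.exp (-s) * Real.exp (-t)) (Ioi 0) := by
    exact (integrableOn_exp_neg_Ioi 0).const_mul _
  have hI : IntegrableOn (fun t : ℝ => Real.exp (-s * Real.cosh t) * Real.exp (-t)) (Ioi 0) := by
    refine Integrable.mono' hi ?_ ?_
    · exact Continuous.aestronglyMeasurable (by fun_prop)
    · refine Eventually.of_forall fun t => ?_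
      rw [Real.norm_of_nonneg (by positivity)]
      exact hb t
  refine ⟨hI, integral_nonneg fun t => by positivity, ?_⟩
  refine (integral_mono hI hi hb).trans ?_
  rw [integral_const_mul, integral_exp_neg_Ioi_zero, mul_one]

lemma aux_coshint (s : ℝ) (hs : 0 < s) :
    IntegrableOn (fun t : ℝ => Real.exp (-s * Real.cosh t) * Real.cosh (1*t)) (Ioi 0) := by
  refine ((aux_sinh s hs).1.add (aux_expint s hs).1).congr (Eventually.of_forall fun t => ?_)
  simp only [Pi.add_apply, one_mul]
  rw [← mul_add, ← Real.cosh_sub_sinh]; ring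

lemma aux_K_bounds (s : ℝ) (hs : 0 < s) :
    Real.exp (-s) / s ≤ besselK 1 s ∧ besselK 1 s ≤ Real.exp (-s) / s + Real.exp (-s) := by
  have h : besselK 1 s = Real.exp (-s) / s +
      ∫ t in Ioi (0:ℝ), Real.exp (-s * Real.cosh t) * Real.exp (-t) := by
    rw [← (aux_sinh s hs).2, ← integral_add (aux_sinh s hs).1 (aux_expint s hs).1]
    unfold besselK
    refine integral_congr_ae (Eventually.of_forall fun t => ?_)
    simp only [one_mul]
    rw [← mul_add, ← Real.cosh_sub_sinh]; ring
  have h2 := (aux_expint s hs).2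
  constructor <;> linarith [h2.1, h2.2]

lemma aux_K_anti : AntitoneOn (besselK 1) (Ioi 0) := by
  intro a ha b hb hab
  refine integral_mono (aux_coshint b hb) (aux_coshint a ha) fun t => ?_
  have : Real.exp (-b * Real.cosh t) ≤ Real.exp (-a * Real.cosh t) := by
    apply Real.exp_le_exp.2
    nlinarith [Real.one_le_cosh t]
  have := Real.cosh_pos (1*t)
  dsimp only
  gcongr

noncomputable def auxJ (y : ℝ) : ℝ :=
  ∫ s in Set.Ioi (0:ℝ), s^3 * besselK 1 s * Real.exp (-s / y)

lemma aux_dom_int : IntegrableOn (fun s : ℝ => s^2 * Real.exp (-(1*s)) + s^3 * Real.exp (-(1*s)))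
    (Ioi 0) := (aux_moment 2 1 one_pos).1.add (aux_moment 3 1 one_pos).1

lemma aux_J_le (y s : ℝ) (hy : 0 < y) (hs : 0 < s) :
    0 ≤ s^3 * besselK 1 s * Real.exp (-s / y) ∧
    s^3 * besselK 1 s * Real.exp (-s / y) ≤ s^2 * Real.exp (-(1*s)) + s^3 * Real.exp (-(1*s)) := by
  have h := aux_K_bounds s hs
  have hK : 0 ≤ besselK 1 s := le_trans (by positivity) h.1
  refine ⟨by positivity, ?_⟩
  have h1 : Real.exp (-s / y) ≤ 1 := by
    apply Real.exp_le_one_iff.2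
    rw [neg_div]
    have := div_pos hs hy
    linarith
  calc s^3 * besselK 1 s * Real.exp (-s / y) ≤ s^3 * besselK 1 s * 1 := by gcongr
    _ ≤ s^3 * (Real.exp (-s) / s + Real.exp (-s)) := by
        rw [mul_one]
        have := h.2
        gcongr
    _ = _ := by
        rw [one_mul]; field_simp

lemma aux_J_int (y : ℝ) (hy : 0 < y) :
    IntegrableOn (fun s : ℝ => s^3 * besselK 1 s * Real.exp (-s / y)) (Ioi 0) := by
  refine Integrable.mono' aux_dom_int ?_ ?_
  · have h : AEMeasurable (besselK 1) (volume.restrict (Ioi (0:ℝ))) :=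
      aemeasurable_restrict_of_antitoneOn measurableSet_Ioi aux_K_anti
    refine AEMeasurable.aestronglyMeasurable ?_
    refine AEMeasurable.mul (AEMeasurable.mul (Measurable.aemeasurable (by fun_prop)) h)
      (Measurable.aemeasurable (by fun_prop))
  · filter_upwards [ae_restrict_mem measurableSet_Ioi] with s hs
    have := aux_J_le y s hy hs
    rw [Real.norm_of_nonneg this.1]
    exact this.2

lemma aux_J_upper (y : ℝ) (hy : 0 < y) : auxJ y ≤ 8 := by
  refine (setIntegral_mono_on (aux_J_int y hy) aux_dom_int measurableSet_Ioi
    fun s hs => (aux_J_le y s hy hs).2).trans ?_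
  rw [integral_add (aux_moment 2 1 one_pos).1 (aux_moment 3 1 one_pos).1,
    (aux_moment 2 1 one_pos).2, (aux_moment 3 1 one_pos).2]
  norm_num [Nat.factorial]

lemma aux_J_lower (y : ℝ) (hy : 0 < y) : 2 / (1 + 1/y)^3 ≤ auxJ y := by
  have hr : 0 < 1 + 1/y := by positivity
  have hm := aux_moment 2 (1 + 1/y) hr
  have : (2:ℝ) / (1 + 1/y)^3 = ∫ s in Ioi (0:ℝ), s^2 * Real.exp (-((1+1/y)*s)) := by
    rw [hm.2]; norm_num [Nat.factorial]
  rw [this]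
  refine setIntegral_mono_on hm.1 (aux_J_int y hy) measurableSet_Ioi fun s hs => ?_
  have hs' : 0 < s := hs
  have h := (aux_K_bounds s hs).1
  calc s^2 * Real.exp (-((1+1/y)*s)) = s^3 * (Real.exp (-s) / s) * Real.exp (-s/y) := by
        rw [show -((1+1/y)*s) = -s + -s/y by ring, Real.exp_add]
        field_simp
    _ ≤ _ := by gcongr

lemma aux_J_mono : MonotoneOn auxJ (Ioi 0) := by
  intro a ha b hb hab
  refine setIntegral_mono_on (aux_J_int a ha) (aux_J_int b hb) measurableSet_Ioi fun s hs => ?_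
  have hs' : 0 < s := hs
  have ha' : 0 < a := ha
  have hK : 0 ≤ besselK 1 s := le_trans (by positivity) (aux_K_bounds s hs).1
  have : Real.exp (-s / a) ≤ Real.exp (-s / b) := by
    apply Real.exp_le_exp.2
    rw [neg_div, neg_div]
    apply neg_le_neg
    gcongr
  gcongr

noncomputable def auxW (y : ℝ) : ℝ := Real.sqrt (y^2 - 1)
noncomputable def auxH (y : ℝ) : ℝ := auxW y - Real.arctan (auxW y)

lemma aux_W_pos {y : ℝ} (hy : 1 < y) : 0 < auxW y := Real.sqrt_pos.2 (by nlinarith)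

lemma aux_W_sq {y : ℝ} (hy : 1 < y) : auxW y ^ 2 = y^2 - 1 := Real.sq_sqrt (by nlinarith)

lemma aux_arccos {y : ℝ} (hy : 1 < y) : Real.arccos (1/y) = Real.arctan (auxW y) := by
  have hy0 : 0 < y := by linarith
  rw [Real.arccos_eq_arctan (by positivity)]
  congr 1
  have : 1 - (1/y)^2 = (y^2 - 1) / y^2 := by field_simp
  rw [this, Real.sqrt_div' _ (by positivity), Real.sqrt_sq hy0.le]
  unfold auxW
  field_simp

lemma aux_W_deriv {y : ℝ} (hy : 1 < y) : HasStrictDerivAt auxW (y / auxW y) y := by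
  have h0 : y^2 - 1 ≠ 0 := by nlinarith
  have h1 : HasStrictDerivAt (fun y : ℝ => y^2 - 1) (2*y) y := by
    have h : HasStrictDerivAt (fun y : ℝ => y^2 - 1) (((2:ℕ):ℝ) * y^(2-1)) y :=
      (hasStrictDerivAt_pow 2 y).sub_const 1
    exact HasStrictDerivAt.congr_deriv h (by norm_num)
  refine (h1.sqrt h0).congr_deriv ?_
  have := aux_W_pos hy
  change 2 * y / (2 * auxW y) = _
  field_simp

lemma aux_arctan_deriv {y : ℝ} (hy : 1 < y) :
    HasStrictDerivAt (fun y => Real.arctan (auxW y)) (1 / (y * auxW y)) y := by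
  refine (aux_W_deriv hy).arctan.congr_deriv ?_
  have := aux_W_pos hy
  have h2 : 0 < y := by linarith
  rw [aux_W_sq hy]
  field_simp
  ring

lemma aux_H_deriv {y : ℝ} (hy : 1 < y) : HasStrictDerivAt auxH (auxW y / y) y := by
  refine ((aux_W_deriv hy).sub (aux_arctan_deriv hy)).congr_deriv ?_
  have := aux_W_pos hy
  have h2 : 0 < y := by linarith
  field_simp
  rw [aux_W_sq hy]

lemma aux_arctan_ineq {w : ℝ} (hw : 0 < w) : w^3 / (3*(1+w^2)) < w - Real.arctan w := by
  let φ : ℝ → ℝ := fun w => w - Real.arctan w - w^3 / (3*(1+w^2))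
  have hd : ∀ w : ℝ, HasDerivAt φ (2*w^4/(3*(1+w^2)^2)) w := by
    intro w
    have h1 : HasDerivAt (fun w : ℝ => 3*(1+w^2)) (3*(2*w)) w := by
      have := ((hasDerivAt_pow 2 w).const_add 1).const_mul 3
      simpa using this
    have h2 : HasDerivAt (fun w : ℝ => w^3) (3*w^2) w := by
      simpa using hasDerivAt_pow 3 w
    refine (((hasDerivAt_id w).sub (Real.hasDerivAt_arctan w)).sub
      (h2.div h1 (by positivity))).congr_deriv ?_
    have : (1 + w^2) ≠ 0 := by positivity
    field_simp
    ring
  have hm : StrictMonoOn φ (Ici 0) := by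
    refine strictMonoOn_of_deriv_pos (convex_Ici 0)
      (fun x _ => (hd x).continuousAt.continuousWithinAt) ?_
    intro x hx
    rw [interior_Ici] at hx
    have : 0 < x := hx
    rw [(hd x).deriv]
    positivity
  have := hm (mem_Ici.2 le_rfl) (mem_Ici.2 hw.le) hw
  simp only [φ] at this
  simp at this
  linarith

lemma aux_H_lower {y : ℝ} (hy : 1 < y) : auxW y ^ 3 / (3*y^2) < auxH y := by
  have := aux_arctan_ineq (aux_W_pos hy)
  rw [aux_W_sq hy] at this
  have e : 1 + (y^2 - 1) = y^2 := by ring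
  rw [e] at this
  exact this

lemma aux_H_pos {y : ℝ} (hy : 1 < y) : 0 < auxH y := by
  refine lt_trans ?_ (aux_H_lower hy)
  have := aux_W_pos hy
  have h2 : 0 < y := by linarith
  positivity

lemma aux_gFun {y : ℝ} (hy : 1 < y) : gFun y = y * Real.arctan (auxW y) / auxW y := by
  have h2 : 0 < y := by linarith
  have := aux_W_pos hy
  unfold gFun
  rw [aux_arccos hy]
  have : 1 - 1/y^2 = (y^2 - 1) / y^2 := by field_simp
  rw [this, Real.sqrt_div' _ (by positivity), Real.sqrt_sq h2.le]
  change _ / (auxW y / y) = _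
  field_simp

noncomputable def auxG1 (y : ℝ) : ℝ := auxH y / auxW y ^ 3
noncomputable def auxG2 (y : ℝ) : ℝ := 1 / (y * auxW y ^ 2) - 3 * y * auxH y / auxW y ^ 5

lemma aux_g_deriv {y : ℝ} (hy : 1 < y) : HasDerivAt gFun (auxG1 y) y := by
  have hW := aux_W_pos hy
  have h2 : 0 < y := by linarith
  have hd : HasDerivAt (fun y => y * Real.arctan (auxW y) / auxW y) (auxG1 y) y := by
    refine (((hasDerivAt_id y).mul (aux_arctan_deriv hy).hasDerivAt).div
      (aux_W_deriv hy).hasDerivAt hW.ne').congr_deriv ?_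
    have e : y^2 = auxW y^2 + 1 := by rw [aux_W_sq hy]; ring
    simp only [id, auxG1, auxH, Pi.mul_apply]
    field_simp
    linear_combination (-Real.arctan (auxW y)) * e
  refine hd.congr_of_eventuallyEq ?_
  filter_upwards [lt_mem_nhds hy] with z hz using aux_gFun hz

lemma aux_G1_deriv {y : ℝ} (hy : 1 < y) : HasDerivAt auxG1 (auxG2 y) y := by
  have hW := aux_W_pos hy
  have h2 : 0 < y := by linarith
  refine ((aux_H_deriv hy).hasDerivAt.div
      ((aux_W_deriv hy).hasDerivAt.pow 3) (pow_ne_zero 3 hW.ne')).congr_deriv ?_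
  simp only [auxG2, Pi.pow_apply]
  field_simp
  norm_num
  try ring

lemma aux_g_deriv2 {y : ℝ} (hy : 1 < y) : deriv (deriv gFun) y = auxG2 y := by
  have : deriv gFun =ᶠ[nhds y] auxG1 := by
    filter_upwards [lt_mem_nhds hy] with z hz using (aux_g_deriv hz).deriv
  rw [this.deriv_eq]
  exact (aux_G1_deriv hy).deriv

lemma aux_G2_neg {y : ℝ} (hy : 1 < y) : auxG2 y < 0 := by
  have hW := aux_W_pos hy
  have h2 : 0 < y := by linarith
  have h := aux_H_lower hy
  have e : auxG2 y = 3 * y / auxW y ^ 5 * (auxW y ^ 3 / (3*y^2) - auxH y) := by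
    unfold auxG2
    field_simp
  rw [e]
  exact mul_neg_of_pos_of_neg (by positivity) (by linarith)

lemma aux_G1_lower {y : ℝ} (hy : 1 < y) : 1 / (3*y^2) < auxG1 y := by
  have hW := aux_W_pos hy
  have h2 : 0 < y := by linarith
  have h := aux_H_lower hy
  unfold auxG1
  rw [lt_div_iff₀ (by positivity)]
  calc _ = auxW y ^ 3 / (3*y^2) := by ring
    _ < _ := h

lemma aux_G1_upper {y : ℝ} (hy : 1 < y) : auxG1 y ≤ 1 / (y^2-1) := by
  have hW := aux_W_pos hy
  have : auxH y ≤ auxW y := by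
    have := Real.arctan_pos.2 hW
    unfold auxH
    linarith
  unfold auxG1
  rw [← aux_W_sq hy, div_le_div_iff₀ (by positivity) (by positivity)]
  nlinarith [mul_le_mul_of_nonneg_right this (sq_nonneg (auxW y))]

lemma aux_H_mono : StrictMonoOn auxH (Ioi 1) := by
  refine strictMonoOn_of_deriv_pos (convex_Ioi 1)
    (fun x hx => (aux_H_deriv hx).hasDerivAt.continuousAt.continuousWithinAt) ?_
  intro x hx
  rw [interior_Ioi] at hx
  have hx' : 1 < x := hx
  have := aux_W_pos hx'
  rw [(aux_H_deriv hx).hasDerivAt.deriv]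
  have h2 : 0 < x := by linarith
  positivity

lemma aux_sigma {y : ℝ} (hy : 1 < y) : sigmaF y = Real.pi / auxH y := by
  unfold sigmaF auxH
  rw [aux_arccos hy]
  rfl

lemma aux_sigma_deriv {y : ℝ} (hy : 1 < y) :
    HasStrictDerivAt sigmaF (-(Real.pi * auxW y / (y * auxH y ^ 2))) y := by
  have hH := aux_H_pos hy
  have h2 : 0 < y := by linarith
  have h : HasStrictDerivAt (fun y => Real.pi / auxH y) (-(Real.pi * auxW y / (y * auxH y ^ 2))) y := by
    have h3 := HasStrictDerivAt.comp y (hasStrictDerivAt_inv hH.ne') (aux_H_deriv hy)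
    refine HasStrictDerivAt.congr_deriv (HasStrictDerivAt.const_mul Real.pi h3) ?_
    field_simp
  refine h.congr_of_eventuallyEq ?_
  filter_upwards [lt_mem_nhds hy] with z hz using (aux_sigma hz).symm

lemma aux_sigma_anti : StrictAntiOn sigmaF (Ioi 1) := by
  intro a ha b hb hab
  rw [aux_sigma ha, aux_sigma hb]
  have h1 := aux_H_mono ha hb hab
  have h2 := aux_H_pos ha
  have := Real.pi_pos
  gcongr

lemma aux_f_deriv {f : ℝ → ℝ} (hf : ∀ t : ℝ, 0 < t → 1 < f t ∧ sigmaF (f t) = t)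
    {t : ℝ} (ht : 0 < t) :
    HasDerivAt f (-(Real.pi * f t / (t^2 * auxW (f t)))) t := by
  obtain ⟨h1, h2⟩ := hf t ht
  have hW := aux_W_pos h1
  have hH := aux_H_pos h1
  have hp := Real.pi_pos
  have h0 : 0 < f t := by linarith
  have hd := aux_sigma_deriv h1
  have hne : -(Real.pi * auxW (f t) / (f t * auxH (f t) ^ 2)) ≠ 0 := by
    rw [neg_ne_zero]; positivity
  have hl := (hd.to_localInverse hne)
  have hr := hd.eventually_right_inverse hne
  have hla : hd.localInverse _ _ _ hne (sigmaF (f t)) = f t := 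
    HasStrictFDerivAt.localInverse_apply_image (hd.hasStrictFDerivAt_equiv hne)
  have hc : ∀ᶠ x in nhds (sigmaF (f t)), 1 < hd.localInverse _ _ _ hne x := by
    apply hl.hasDerivAt.continuousAt.eventually
    rw [hla]
    exact lt_mem_nhds h1
  rw [h2] at hl hr hc
  have hl' := hl.hasDerivAt.congr_of_eventuallyEq (f₁ := f) (by
    filter_upwards [hr, hc, lt_mem_nhds ht] with x hx1 hx2 hx3
    obtain ⟨h3, h4⟩ := hf x hx3
    exact aux_sigma_anti.injOn h3 hx2 (h4.trans hx1.symm))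
  refine hl'.congr_deriv ?_
  have e : t = Real.pi / auxH (f t) := by rw [← aux_sigma h1, h2]
  have e2 : auxH (f t) = Real.pi / t := by rw [eq_div_iff ht.ne']; rw [eq_div_iff hH.ne'] at e; linarith
  rw [e2]
  field_simp

lemma aux_f_top {f : ℝ → ℝ} (hf : ∀ t : ℝ, 0 < t → 1 < f t ∧ sigmaF (f t) = t) :
    Tendsto f (nhdsWithin 0 (Ioi 0)) atTop := by
  rw [tendsto_atTop]
  intro b
  have hM : (1:ℝ) < max b 2 := lt_of_lt_of_le (by norm_num) (le_max_right b 2)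
  have hs : 0 < sigmaF (max b 2) := by
    rw [aux_sigma hM]; exact div_pos Real.pi_pos (aux_H_pos hM)
  filter_upwards [Ioo_mem_nhdsGT hs] with t ht
  obtain ⟨h1, h2⟩ := hf t ht.1
  by_contra hlt
  have : f t < max b 2 := lt_of_lt_of_le (not_le.1 hlt) (le_max_left _ _)
  have := aux_sigma_anti h1 hM this
  rw [h2] at this
  linarith [ht.2]

lemma aux_f_one {f : ℝ → ℝ} (hf : ∀ t : ℝ, 0 < t → 1 < f t ∧ sigmaF (f t) = t) :
    Tendsto f atTop (nhdsWithin 1 (Ioi 1)) := by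
  refine tendsto_nhdsWithin_iff.2 ⟨?_, ?_⟩
  · rw [tendsto_order]
    constructor
    · intro a ha
      filter_upwards [eventually_gt_atTop 0] with t ht
      exact ha.trans (hf t ht).1
    · intro M hM
      filter_upwards [eventually_gt_atTop 0, eventually_gt_atTop (sigmaF M)] with t ht ht2
      obtain ⟨h1, h2⟩ := hf t ht
      by_contra hlt
      have := aux_sigma_anti.antitoneOn hM h1 (not_lt.1 hlt)
      rw [h2] at this
      linarith
  · filter_upwards [eventually_gt_atTop 0] with t ht using (hf t ht).1

/-- comparison functions for `theta0`, with `auxJ` replaced by a function `j` of `1/f t`. -/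
noncomputable def auxD (j : ℝ → ℝ) (f : ℝ → ℝ) (t : ℝ) : ℝ :=
  -(Real.pi/(8*t^2)) * auxG2 (f t) * f t / auxW (f t)
    + (auxW (f t) / (6*Real.pi*t^2*(f t)^3)) * j (1 / f t)

noncomputable def auxP (Q : ℝ → ℝ) (y : ℝ) : ℝ := auxG1 y / 8 + 1/(6*Real.pi^2) * Q (1/y)

lemma aux_P_deriv {f : ℝ → ℝ} (hf : ∀ t : ℝ, 0 < t → 1 < f t ∧ sigmaF (f t) = t)
    {j Q : ℝ → ℝ} (hQ : ∀ c : ℝ, 0 < c → HasDerivAt Q ((1-c^2) * j c) c)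
    {t : ℝ} (ht : 0 < t) :
    HasDerivAt (fun t => auxP Q (f t)) (auxD j f t) t := by
  obtain ⟨h1, h2⟩ := hf t ht
  have hW := aux_W_pos h1
  have hp := Real.pi_pos
  have h0 : 0 < f t := by linarith
  have hP : HasDerivAt (auxP Q) (auxG2 (f t) / 8 +
      1/(6*Real.pi^2) * (((1-(1/f t)^2) * j (1/f t)) * (-1/(f t)^2))) (f t) := by
    have hi : HasDerivAt (fun y : ℝ => 1 / y) (-1/(f t)^2) (f t) := by
      simpa [one_div, neg_div] using hasDerivAt_inv h0.ne'
    have := (hQ (1/f t) (by positivity)).comp (f t) hi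
    exact ((aux_G1_deriv h1).div_const 8).add (this.const_mul _)
  refine (hP.comp t (aux_f_deriv hf ht)).congr_deriv ?_
  unfold auxD
  have e : 1 - (1/f t)^2 = auxW (f t)^2 / (f t)^2 := by
    rw [aux_W_sq h1]; field_simp
  rw [e]
  field_simp
  try ring

lemma aux_theta {f : ℝ → ℝ} (hf : ∀ t : ℝ, 0 < t → 1 < f t ∧ sigmaF (f t) = t)
    {t : ℝ} (ht : 0 < t) :
    theta0 f t = -(Real.pi/(8*t^2)) * auxG2 (f t) * f t / auxW (f t)
    + (auxW (f t) / (6*Real.pi*t^2*(f t)^3)) * auxJ (f t) := by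
  unfold theta0 auxJ
  rw [aux_g_deriv2 (hf t ht).1]
  rfl

noncomputable def auxjL (c : ℝ) : ℝ := 2 / (1+c)^3
noncomputable def auxQL (c : ℝ) : ℝ := 4 * (1 - 1/(1+c)) - 2 * Real.log (1+c)
noncomputable def auxjU (_c : ℝ) : ℝ := 8
noncomputable def auxQU (c : ℝ) : ℝ := 8 * (c - c^3/3)

lemma aux_QL (c : ℝ) (hc : 0 < c) : HasDerivAt auxQL ((1-c^2) * auxjL c) c := by
  have h1 : HasDerivAt (fun c : ℝ => 1 + c) 1 c := (hasDerivAt_id c).const_add 1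
  have hp : 0 < 1 + c := by linarith
  have h2 : HasDerivAt (fun c : ℝ => 1/(1+c)) (-1/(1+c)^2) c := by
    simp only [one_div]
    exact h1.fun_inv hp.ne'
  have h3 := h1.log hp.ne'
  refine (((h2.const_sub 1).const_mul 4).sub (h3.const_mul 2)).congr_deriv ?_
  unfold auxjL
  field_simp
  ring

lemma aux_QU (c : ℝ) (hc : 0 < c) : HasDerivAt auxQU ((1-c^2) * auxjU c) c := by
  have h2 : HasDerivAt (fun w : ℝ => w^3) (3*c^2) c := by
    simpa using hasDerivAt_pow 3 c
  refine (((hasDerivAt_id c).sub (h2.div_const 3)).const_mul 8).congr_deriv ?_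
  unfold auxjU
  ring

lemma aux_theta_lower {f : ℝ → ℝ} (hf : ∀ t : ℝ, 0 < t → 1 < f t ∧ sigmaF (f t) = t)
    {t : ℝ} (ht : 0 < t) : auxD auxjL f t ≤ theta0 f t := by
  obtain ⟨h1, -⟩ := hf t ht
  have hW := aux_W_pos h1
  have hp := Real.pi_pos
  have h0 : 0 < f t := by linarith
  rw [aux_theta hf ht]
  unfold auxD auxjL
  have := aux_J_lower (f t) h0
  gcongr

lemma aux_theta_upper {f : ℝ → ℝ} (hf : ∀ t : ℝ, 0 < t → 1 < f t ∧ sigmaF (f t) = t)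
    {t : ℝ} (ht : 0 < t) : theta0 f t ≤ auxD auxjU f t := by
  obtain ⟨h1, -⟩ := hf t ht
  have hW := aux_W_pos h1
  have hp := Real.pi_pos
  have h0 : 0 < f t := by linarith
  rw [aux_theta hf ht]
  unfold auxD auxjU
  have := aux_J_upper (f t) h0
  gcongr

lemma aux_D_pos {f : ℝ → ℝ} (hf : ∀ t : ℝ, 0 < t → 1 < f t ∧ sigmaF (f t) = t)
    {t : ℝ} (ht : 0 < t) : 0 < auxD auxjL f t := by
  obtain ⟨h1, -⟩ := hf t ht
  have hW := aux_W_pos h1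
  have hp := Real.pi_pos
  have h0 : 0 < f t := by linarith
  have hG : 0 < -auxG2 (f t) := by linarith [aux_G2_neg h1]
  have e : auxD auxjL f t = (Real.pi/(8*t^2)) * (-auxG2 (f t)) * f t / auxW (f t)
    + (auxW (f t) / (6*Real.pi*t^2*(f t)^3)) * (2 / (1 + 1 / f t)^3) := by
    unfold auxD auxjL; ring
  rw [e]
  positivity

lemma aux_theta_pos {f : ℝ → ℝ} (hf : ∀ t : ℝ, 0 < t → 1 < f t ∧ sigmaF (f t) = t)
    {t : ℝ} (ht : 0 < t) : 0 < theta0 f t :=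
  (aux_D_pos hf ht).trans_le (aux_theta_lower hf ht)

lemma aux_P_zero {Q : ℝ → ℝ} (hQ : ContinuousAt Q 0) (hQ0 : Q 0 = 0) :
    Tendsto (auxP Q) atTop (nhds 0) := by
  have h1 : Tendsto auxG1 atTop (nhds 0) := by
    have hu : Tendsto (fun y : ℝ => 1 / (y^2-1)) atTop (nhds 0) := by
      simp only [one_div]
      apply Tendsto.inv_tendsto_atTop
      exact tendsto_atTop_add_const_right _ (-1) (tendsto_pow_atTop two_ne_zero)
    refine tendsto_of_tendsto_of_tendsto_of_le_of_le' tendsto_const_nhds hu ?_ ?_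
    · filter_upwards [eventually_gt_atTop 1] with y hy
      exact le_trans (by positivity) (aux_G1_lower hy).le
    · filter_upwards [eventually_gt_atTop 1] with y hy using aux_G1_upper hy
  have h2 : Tendsto (fun y : ℝ => Q (1/y)) atTop (nhds 0) := by
    have h3 : Tendsto (fun y : ℝ => 1/y) atTop (nhds 0) := by
      simpa using tendsto_inv_atTop_zero (𝕜 := ℝ)
    rw [← hQ0]
    exact hQ.tendsto.comp h3
  have := (h1.div_const 8).add (h2.const_mul (1/(6*Real.pi^2)))
  simp only [zero_div, mul_zero, add_zero] at this
  exact this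

lemma aux_QU_cont : ContinuousAt auxQU 0 := by unfold auxQU; fun_prop
lemma aux_QL_cont {c : ℝ} (hc : 0 ≤ c) : ContinuousAt auxQL c := by
  have : 1 + c ≠ 0 := by positivity
  unfold auxQL
  fun_prop (disch := assumption)

lemma aux_f_cont {f : ℝ → ℝ} (hf : ∀ t : ℝ, 0 < t → 1 < f t ∧ sigmaF (f t) = t) :
    ContinuousOn f (Ioi 0) :=
  fun _ ht => (aux_f_deriv hf ht).continuousAt.continuousWithinAt

lemma aux_W_cont : Continuous auxW := by unfold auxW; fun_prop
lemma aux_H_cont : Continuous auxH := by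
  unfold auxH
  exact aux_W_cont.sub (Real.continuous_arctan.comp aux_W_cont)

lemma aux_G2_meas : Measurable auxG2 := by
  have h1 := aux_W_cont.measurable
  have h2 := aux_H_cont.measurable
  unfold auxG2
  fun_prop

lemma aux_theta_meas {f : ℝ → ℝ} (hf : ∀ t : ℝ, 0 < t → 1 < f t ∧ sigmaF (f t) = t) :
    AEMeasurable (theta0 f) (volume.restrict (Ioi 0)) := by
  have hfm : AEMeasurable f (volume.restrict (Ioi 0)) :=
    (aux_f_cont hf).aemeasurable measurableSet_Ioi
  have hfa : AntitoneOn f (Ioi 0) := by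
    intro a ha b hb hab
    obtain ⟨h1, h2⟩ := hf a ha
    obtain ⟨h3, h4⟩ := hf b hb
    by_contra hlt
    have := aux_sigma_anti h1 h3 (not_le.1 hlt)
    rw [h2, h4] at this
    linarith
  have hJ : AEMeasurable (fun t => auxJ (f t)) (volume.restrict (Ioi 0)) := by
    refine aemeasurable_restrict_of_antitoneOn measurableSet_Ioi ?_
    intro a ha b hb hab
    exact aux_J_mono (mem_Ioi.2 (one_pos.trans (hf b hb).1)) (mem_Ioi.2 (one_pos.trans (hf a ha).1))
      (hfa ha hb hab)
  have hW : AEMeasurable (fun t => auxW (f t)) (volume.restrict (Ioi 0)) :=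
    aux_W_cont.measurable.comp_aemeasurable hfm
  have hG : AEMeasurable (fun t => auxG2 (f t)) (volume.restrict (Ioi 0)) :=
    aux_G2_meas.comp_aemeasurable hfm
  have : AEMeasurable (fun t => -(Real.pi/(8*t^2)) * auxG2 (f t) * f t / auxW (f t)
    + (auxW (f t) / (6*Real.pi*t^2*(f t)^3)) * auxJ (f t)) (volume.restrict (Ioi 0)) := by
    fun_prop
  refine this.congr ?_
  filter_upwards [ae_restrict_mem measurableSet_Ioi] with t ht using (aux_theta hf ht).symm

lemma aux_theta_int {f : ℝ → ℝ} (hf : ∀ t : ℝ, 0 < t → 1 < f t ∧ sigmaF (f t) = t) (x : ℝ) :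
    IntegrableOn (theta0 f) (Ioc 0 x) := by
  have hU : IntegrableOn (auxD auxjU f) (Ioc 0 x) := by
    let R : ℝ → ℝ := fun t => if 0 < t then auxP auxQU (f t) else 0
    have hR : ∀ t, 0 < t → HasDerivAt R (auxD auxjU f t) t := by
      intro t ht
      refine (aux_P_deriv hf aux_QU ht).congr_of_eventuallyEq ?_
      filter_upwards [lt_mem_nhds ht] with s hs
      simp [R, hs]
    refine intervalIntegral.integrableOn_deriv_of_nonneg (g := R) ?_ (fun t ht => hR t ht.1) ?_
    · intro t ht
      rcases eq_or_lt_of_le ht.1 with h | h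
      · subst h
        have h0 : Tendsto R (nhdsWithin 0 (Ioi 0)) (nhds (R 0)) := by
          have e : R 0 = 0 := by simp [R]
          rw [e]
          refine ((aux_P_zero aux_QU_cont (by simp [auxQU])).comp (aux_f_top hf)).congr' ?_
          filter_upwards [self_mem_nhdsWithin] with s hs
          have hs' : 0 < s := hs
          simp [R, hs']
        have h1 : ContinuousWithinAt R (Ioi 0) 0 := h0
        exact (continuousWithinAt_Ioi_iff_Ici.1 h1).mono (fun z hz => hz.1)
      · exact (hR t h).continuousAt.continuousWithinAt
    · intro t ht
      exact ((aux_theta_pos hf ht.1).trans_le (aux_theta_upper hf ht.1)).le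
  refine Integrable.mono' hU ?_ ?_
  · exact ((aux_theta_meas hf).mono_set (fun z hz => hz.1)).aestronglyMeasurable
  · filter_upwards [ae_restrict_mem measurableSet_Ioc] with t ht
    rw [Real.norm_of_nonneg (aux_theta_pos hf ht.1).le]
    exact aux_theta_upper hf ht.1

lemma aux_numeric : 1/(2*Real.pi^2) < 1/(3*1^2)/8 + 1/(6*Real.pi^2) * auxQL (1/1) := by
  have h1 := Real.pi_gt_d2
  have h2 := Real.log_two_lt_d9
  have hp := Real.pi_pos
  have e : auxQL (1/1) = 2 - 2 * Real.log 2 := by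
    unfold auxQL; norm_num
  rw [e]
  have : 0 < 1/(6*Real.pi^2) * (Real.pi^2/4 + (2 - 2*Real.log 2) - 3) := by
    apply mul_pos (by positivity)
    nlinarith
  have e2 : 1/(6*Real.pi^2) * (Real.pi^2/4 + (2 - 2*Real.log 2) - 3) =
    1/(3*1^2)/8 + 1/(6*Real.pi^2) * (2 - 2 * Real.log 2) - 1/(2*Real.pi^2) := by
    field_simp
    ring
  linarith

lemma aux_ii {f : ℝ → ℝ} (hf : ∀ t : ℝ, 0 < t → 1 < f t ∧ sigmaF (f t) = t) {a b : ℝ}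
    (ha : 0 ≤ a) (hb : 0 ≤ b) : IntervalIntegrable (theta0 f) volume a b := by
  have h : ∀ c : ℝ, 0 ≤ c → IntervalIntegrable (theta0 f) volume 0 c := fun c hc =>
    (intervalIntegrable_iff_integrableOn_Ioc_of_le hc).2 (aux_theta_int hf c)
  exact (h a ha).symm.trans (h b hb)

lemma aux_I_mono {f : ℝ → ℝ} (hf : ∀ t : ℝ, 0 < t → 1 < f t ∧ sigmaF (f t) = t) :
    StrictMonoOn (fun x => ∫ t in (0:ℝ)..x, theta0 f t) (Ici 0) := by
  intro a ha b hb hab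
  have ha' : 0 ≤ a := ha
  have hb' : 0 ≤ b := hb
  have h := intervalIntegral.intervalIntegral_pos_of_pos_on (aux_ii hf ha' hb')
    (fun x hx => aux_theta_pos hf (ha'.trans_lt hx.1)) hab
  have h2 := intervalIntegral.integral_add_adjacent_intervals (aux_ii hf le_rfl ha')
    (aux_ii hf ha' hb')
  dsimp only
  linarith

lemma aux_I_cont {f : ℝ → ℝ} (hf : ∀ t : ℝ, 0 < t → 1 < f t ∧ sigmaF (f t) = t) :
    ContinuousOn (fun x => ∫ t in (0:ℝ)..x, theta0 f t) (Ici 0) := by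
  intro x hx
  have hx' : 0 ≤ x := hx
  have h1 : IntegrableOn (theta0 f) (uIcc 0 (x+1)) := by
    rw [uIcc_of_le (by linarith), integrableOn_Icc_iff_integrableOn_Ioc]
    exact aux_theta_int hf _
  have h2 := intervalIntegral.continuousOn_primitive_interval h1
  rw [uIcc_of_le (by linarith)] at h2
  refine (h2 x ⟨hx', by linarith⟩).mono_of_mem_nhdsWithin ?_
  rw [← Ici_inter_Iic]
  exact inter_mem_nhdsWithin _ (Iic_mem_nhds (by linarith))

lemma aux_I_large {f : ℝ → ℝ} (hf : ∀ t : ℝ, 0 < t → 1 < f t ∧ sigmaF (f t) = t) :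
    ∃ x, 0 < x ∧ 1/(2*Real.pi^2) < ∫ t in (0:ℝ)..x, theta0 f t := by
  have hlow : ∀ x, 0 < x → auxP auxQL (f x) ≤ ∫ t in (0:ℝ)..x, theta0 f t := by
    intro x hx
    have h1 : ∀ ε ∈ Ioo 0 x, auxP auxQL (f x) - auxP auxQL (f ε) ≤
        ∫ t in (0:ℝ)..x, theta0 f t := by
      intro ε hε
      have hd : ∀ t ∈ uIcc ε x, HasDerivAt (fun t => auxP auxQL (f t)) (auxD auxjL f t) t := by
        intro t ht
        rw [uIcc_of_le hε.2.le] at ht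
        exact aux_P_deriv hf aux_QL (hε.1.trans_le ht.1)
      have hi : IntervalIntegrable (auxD auxjL f) volume ε x := by
        rw [intervalIntegrable_iff_integrableOn_Ioc_of_le hε.2.le]
        refine intervalIntegral.integrableOn_deriv_of_nonneg
          (g := fun t => auxP auxQL (f t)) ?_ ?_ ?_
        · rw [← uIcc_of_le hε.2.le]
          exact fun t ht => (hd t ht).continuousAt.continuousWithinAt
        · intro t ht
          exact aux_P_deriv hf aux_QL (hε.1.trans ht.1)
        · intro t ht
          exact (aux_D_pos hf (hε.1.trans ht.1)).le
      have h2 := intervalIntegral.integral_eq_sub_of_hasDerivAt hd hi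
      have h3 := intervalIntegral.integral_mono_on hε.2.le hi (aux_ii hf hε.1.le hx.le)
        (fun t ht => aux_theta_lower hf (hε.1.trans_le ht.1))
      have h4 := intervalIntegral.integral_add_adjacent_intervals (aux_ii hf le_rfl hε.1.le)
        (aux_ii hf hε.1.le hx.le)
      have h5 := intervalIntegral.intervalIntegral_pos_of_pos_on (aux_ii hf le_rfl hε.1.le)
        (fun x hx => aux_theta_pos hf hx.1) hε.1
      linarith
    have h0 : Tendsto (fun ε => auxP auxQL (f x) - auxP auxQL (f ε)) (nhdsWithin 0 (Ioi 0))
        (nhds (auxP auxQL (f x) - 0)) :=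
      tendsto_const_nhds.sub ((aux_P_zero (aux_QL_cont le_rfl) (by simp [auxQL])).comp
        (aux_f_top hf))
    rw [sub_zero] at h0
    refine le_of_tendsto h0 ?_
    filter_upwards [Ioo_mem_nhdsGT hx] with ε hε using h1 ε hε
  have hc : ContinuousAt (fun y : ℝ => 1/(3*y^2)/8 + 1/(6*Real.pi^2) * auxQL (1/y)) 1 := by
    have h1 : ContinuousAt (fun y : ℝ => auxQL (1/y)) 1 := by
      refine ContinuousAt.comp (g := auxQL) (f := fun y : ℝ => 1/y) ?_ ?_
      · exact aux_QL_cont (by norm_num)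
      · fun_prop (disch := norm_num)
    have h2 : ContinuousAt (fun y : ℝ => 1/(3*y^2)/8) 1 := by
      fun_prop (disch := norm_num)
    exact h2.add (continuousAt_const.mul h1)
  have hev := (hc.tendsto.mono_left nhdsWithin_le_nhds).comp (aux_f_one hf)
  have hev2 := hev.eventually (lt_mem_nhds aux_numeric)
  obtain ⟨x, hx1, hx2⟩ := (hev2.and (eventually_gt_atTop 0)).exists
  refine ⟨x, hx2, lt_of_lt_of_le hx1 (le_trans ?_ (hlow x hx2))⟩
  have := (aux_G1_lower (hf x hx2).1).le
  simp only [Function.comp, auxP]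
  gcongr

lemma aux_pre_cont : ContinuousOn (fun y : ℝ => y / Real.sqrt (y^2-1)) (Ioi 1) := by
  refine ContinuousOn.div continuousOn_id aux_W_cont.continuousOn ?_
  intro y hy
  exact (aux_W_pos hy).ne'

lemma aux_pre_top : Tendsto (fun y : ℝ => y / Real.sqrt (y^2-1)) atTop (nhds 1) := by
  have h : Tendsto (fun y : ℝ => (Real.sqrt (1 - (y⁻¹)^2))⁻¹) atTop (nhds 1) := by
    have h1 : Tendsto (fun y : ℝ => y⁻¹) atTop (nhds 0) := tendsto_inv_atTop_zero
    have h2 : ContinuousAt (fun c : ℝ => (Real.sqrt (1 - c^2))⁻¹) 0 := by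
      refine ContinuousAt.inv₀ (by fun_prop) (by simp)
    have := h2.tendsto.comp h1
    simp only [ne_eq, OfNat.ofNat_ne_zero, not_false_eq_true, zero_pow, sub_zero, Real.sqrt_one,
      inv_one] at this
    exact this
  refine h.congr' ?_
  filter_upwards [eventually_gt_atTop 1] with y hy
  have h0 : 0 < y := by linarith
  have : 1 - (y⁻¹)^2 = (y^2 - 1) / y^2 := by field_simp
  rw [this, Real.sqrt_div' _ (by positivity), Real.sqrt_sq h0.le, inv_div]

lemma aux_pre_one : Tendsto (fun y : ℝ => y / Real.sqrt (y^2-1)) (nhdsWithin 1 (Ioi 1)) atTop := by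
  have h1 : Tendsto (fun y : ℝ => Real.sqrt (y^2-1)) (nhdsWithin 1 (Ioi 1))
      (nhdsWithin 0 (Ioi 0)) := by
    refine tendsto_nhdsWithin_iff.2 ⟨?_, ?_⟩
    · have : Tendsto auxW (nhds 1) (nhds (auxW 1)) := aux_W_cont.tendsto 1
      have e : auxW 1 = 0 := by simp [auxW]
      rw [e] at this
      exact this.mono_left nhdsWithin_le_nhds
    · filter_upwards [self_mem_nhdsWithin] with y hy using aux_W_pos hy
  have h2 := tendsto_inv_nhdsGT_zero.comp h1
  have h3 : Tendsto (fun y : ℝ => y) (nhdsWithin 1 (Ioi 1)) (nhds 1) :=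
    tendsto_id.mono_left nhdsWithin_le_nhds
  exact h3.pos_mul_atTop one_pos h2

theorem stmt_10
    (f : ℝ → ℝ) (hf : ∀ t : ℝ, 0 < t → 1 < f t ∧ sigmaF (f t) = t) :
    ContinuousOn (zetaC f) (Set.Ioi 0) ∧
    Filter.Tendsto (zetaC f) (nhdsWithin 0 (Set.Ioi 0)) (nhds (1/(8*Real.pi))) ∧
    Filter.Tendsto (zetaC f) Filter.atTop Filter.atBot ∧
    ∃ x₀ : ℝ, 0 < x₀ ∧ zetaC f x₀ = 0 ∧
      ∀ x : ℝ, 0 < x → zetaC f x = 0 → x = x₀ := by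
  have hp := Real.pi_pos
  have hzero : ∀ x, 0 < x → (zetaC f x = 0 ↔ ∫ t in (0:ℝ)..x, theta0 f t = 1/(2*Real.pi^2)) := by
    intro x hx
    have h1 := (hf x hx).1
    have hW : 0 < Real.sqrt ((f x)^2 - 1) := aux_W_pos h1
    have h0 : 0 < f x := by linarith
    have hpos : (Real.pi/4) * (f x / Real.sqrt ((f x)^2 - 1)) ≠ 0 := by positivity
    unfold zetaC
    rw [mul_eq_zero, or_iff_right hpos, sub_eq_zero, eq_comm]
  obtain ⟨X, hX, hXI⟩ := aux_I_large hf
  refine ⟨?_, ?_, ?_, ?_⟩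
  · unfold zetaC
    have h1 : ContinuousOn (fun x => f x / Real.sqrt ((f x)^2-1)) (Ioi 0) :=
      aux_pre_cont.comp (aux_f_cont hf) (fun x hx => (hf x hx).1)
    exact (continuousOn_const.mul h1).mul
      (continuousOn_const.sub ((aux_I_cont hf).mono Ioi_subset_Ici_self))
  · have h1 := (aux_pre_top.comp (aux_f_top hf)).const_mul (Real.pi/4)
    have h2 : Tendsto (fun x => ∫ t in (0:ℝ)..x, theta0 f t) (nhdsWithin 0 (Ioi 0)) (nhds 0) := by
      have := ((aux_I_cont hf) 0 (mem_Ici.2 le_rfl)).mono Ioi_subset_Ici_self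
      simpa [ContinuousWithinAt] using this
    have h3 := h1.mul (h2.const_sub (1/(2*Real.pi^2)))
    have e : Real.pi/4 * 1 * (1/(2*Real.pi^2) - 0) = 1/(8*Real.pi) := by
      field_simp; norm_num
    rw [e] at h3
    exact h3
  · have h1 := (aux_pre_one.comp (aux_f_one hf)).const_mul_atTop (show 0 < Real.pi/4 by positivity)
    have hC : 1/(2*Real.pi^2) - (∫ t in (0:ℝ)..X, theta0 f t) < 0 := by linarith
    refine tendsto_atBot_mono' _ ?_ (h1.atTop_mul_const_of_neg hC)
    filter_upwards [eventually_ge_atTop X] with x hx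
    have hx0 : 0 < x := hX.trans_le hx
    have hm := (aux_I_mono hf).monotoneOn (mem_Ici.2 hX.le) (mem_Ici.2 hx0.le) hx
    have h1 := (hf x hx0).1
    have hW : 0 < Real.sqrt ((f x)^2 - 1) := aux_W_pos h1
    have h0 : 0 < f x := by linarith
    unfold zetaC
    simp only [Function.comp]
    gcongr
  · have hiv := intermediate_value_Ioo (f := fun x => ∫ t in (0:ℝ)..x, theta0 f t) hX.le
      ((aux_I_cont hf).mono Icc_subset_Ici_self)
    have hmem : 1/(2*Real.pi^2) ∈ Ioo (∫ t in (0:ℝ)..0, theta0 f t) (∫ t in (0:ℝ)..X, theta0 f t) := by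
      refine ⟨?_, hXI⟩
      rw [intervalIntegral.integral_same]; positivity
    obtain ⟨x₀, hx₀, he⟩ := hiv hmem
    refine ⟨x₀, hx₀.1, (hzero x₀ hx₀.1).2 he, ?_⟩
    intro x hx hxz
    have := (hzero x hx).1 hxz
    exact (aux_I_mono hf).injOn (mem_Ici.2 hx.le) (mem_Ici.2 hx₀.1.le) (this.trans he.symm)
end

section
/- Let α > 1 be such that σ(α) is rational, and write σ(α) = p/q with p, q ∈ ℕ coprime. Assume that 4 does not divide p or that q is even. Then there exists c > 0 such that for every ℓ ∈ ℕ₀ and k ∈ ℕ, either j_{ℓ,k}² − α²ℓ² = 0 or |j_{ℓ,k}² − α²ℓ²| ≥ c·j_{ℓ,k}. -/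
open Real Set Filter

/-- The Bessel function of the first kind,
`J_ν(x) = Σ_{n=0}^∞ ((−1)ⁿ/(n!·Γ(n+ν+1)))·(x/2)^{2n+ν}`. -/
noncomputable def besselJ (ν x : ℝ) : ℝ :=
  ∑' n : ℕ, ((-1 : ℝ)^n / ((n.factorial : ℝ) * Real.Gamma ((n : ℝ) + ν + 1)))
    * (x/2) ^ (2*(n:ℝ) + ν)

lemma aux_hasSum (f g : ℝ → ℂ) (hf : Continuous f) (hg : Continuous g)
    (hf1 : ∀ t, ‖f t‖ ≤ 1) (C : ℝ) (hg1 : ∀ t, ‖g t‖ ≤ C) (z : ℂ) (a b : ℝ) :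
    HasSum (fun n : ℕ => z ^ n / (n.factorial : ℂ) * ∫ t in a..b, g t * f t ^ n)
      (∫ t in a..b, g t * Complex.exp (z * f t)) := by
  have hC : 0 ≤ C := (norm_nonneg _).trans (hg1 0)
  have h := intervalIntegral.hasSum_integral_of_dominated_convergence (a := a) (b := b)
    (μ := MeasureTheory.volume)
    (F := fun (n : ℕ) (t : ℝ) => z ^ n / (n.factorial : ℂ) * (g t * f t ^ n))
    (f := fun t => g t * Complex.exp (z * f t))
    (fun n _ => C * (‖z‖ ^ n / n.factorial)) ?_ ?_ ?_ ?_ ?_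
  · simpa only [intervalIntegral.integral_const_mul] using h
  · intro n
    exact (by fun_prop : Continuous _).aestronglyMeasurable
  · intro n
    refine Eventually.of_forall fun t _ => ?_
    rw [norm_mul, norm_mul, norm_div, norm_pow, norm_pow, Complex.norm_natCast]
    have h1 : ‖f t‖ ^ n ≤ 1 := pow_le_one₀ (norm_nonneg _) (hf1 t)
    have h2 : ‖g t‖ * ‖f t‖ ^ n ≤ C * 1 := mul_le_mul (hg1 t) h1 (by positivity) hC
    have h3 : 0 ≤ ‖z‖ ^ n / (n.factorial : ℝ) := by positivity
    nlinarith
  · refine Eventually.of_forall fun t _ => ?_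
    exact (Real.summable_pow_div_factorial ‖z‖).mul_left C
  · exact intervalIntegrable_const
  · refine Eventually.of_forall fun t _ => ?_
    have h := (NormedSpace.expSeries_div_hasSum_exp (𝔸 := ℂ) (z * f t))
    rw [← Complex.exp_eq_exp_ℂ] at h
    have e : (fun n : ℕ => z ^ n / (n.factorial : ℂ) * (g t * f t ^ n)) =
        fun n : ℕ => g t * ((z * f t) ^ n / (n.factorial : ℂ)) := by
      ext n; rw [mul_pow]; ring
    rw [e]
    exact h.mul_left (g t)

lemma aux_orth (m n : ℕ) : (∫ t in (-π)..π, Complex.exp (-(n : ℂ) * Complex.I * t) *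
    Complex.exp (Complex.I * t) ^ m) = if m = n then (2 * π : ℂ) else 0 := by
  have h : ∀ t : ℝ, Complex.exp (-(n : ℂ) * Complex.I * t) * Complex.exp (Complex.I * t) ^ m
      = Complex.exp ((((m : ℂ) - n) * Complex.I) * t) := by
    intro t
    rw [← Complex.exp_nat_mul, ← Complex.exp_add]; congr 1; ring
  simp only [h]
  split_ifs with hmn
  · subst hmn; simp; ring
  · have hne : (((m : ℂ) - n) * Complex.I) ≠ 0 :=
      mul_ne_zero (sub_ne_zero.2 (by exact_mod_cast hmn)) Complex.I_ne_zero
    rw [integral_exp_mul_complex hne, div_eq_zero_iff]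
    left
    rw [sub_eq_zero, Complex.exp_eq_exp_iff_exists_int]
    refine ⟨(m : ℤ) - n, ?_⟩
    push_cast; ring

lemma aux_inner (z : ℂ) (n : ℕ) : (∫ t in (-π)..π, Complex.exp (-(n : ℂ) * Complex.I * t) *
    Complex.exp (z * Complex.exp (Complex.I * t))) = z ^ n / (n.factorial : ℂ) * (2 * π) := by
  have h := aux_hasSum (fun t => Complex.exp (Complex.I * t))
    (fun t => Complex.exp (-(n : ℂ) * Complex.I * t)) (by fun_prop) (by fun_prop)
    (fun t => by rw [Complex.norm_exp]; simp) 1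
    (fun t => by rw [Complex.norm_exp]; simp) z (-π) π
  simp only [aux_orth] at h
  refine h.unique ?_
  have := hasSum_ite_eq n (z ^ n / (n.factorial : ℂ) * (2 * π))
  convert this using 2 with m
  split_ifs with hm
  · subst hm; rfl
  · simp

lemma bessel_complex (l : ℕ) (x : ℝ) (hx : 0 < x) :
    (∫ t in (-π)..π, Complex.exp (-(l : ℂ) * Complex.I * t + x * Complex.sin t * Complex.I))
      = 2 * π * (besselJ l x : ℂ) := by
  have h := aux_hasSum (fun t => Complex.exp (-Complex.I * t))
    (fun t => Complex.exp (-(l : ℂ) * Complex.I * t) *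
      Complex.exp ((x / 2 : ℝ) * Complex.exp (Complex.I * t))) (by fun_prop) (by fun_prop)
    (fun t => by rw [Complex.norm_exp]; simp) (Real.exp (x / 2))
    (fun t => by
      rw [norm_mul, Complex.norm_exp, Complex.norm_exp]
      simp only [Complex.re_ofReal_mul]
      simp
      have h1 : (Complex.exp (Complex.I * t)).re ≤ 1 := by
        rw [mul_comm, Complex.exp_ofReal_mul_I_re]; exact Real.cos_le_one t
      nlinarith) (-(x / 2 : ℝ)) (-π) π
  have h2 : ∀ n : ℕ, (∫ t in (-π)..π, (Complex.exp (-(l : ℂ) * Complex.I * t) *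
      Complex.exp ((x / 2 : ℝ) * Complex.exp (Complex.I * t))) *
        Complex.exp (-Complex.I * t) ^ n) =
      ((x / 2 : ℝ) : ℂ) ^ (n + l) / ((n + l).factorial : ℂ) * (2 * π) := by
    intro n
    rw [← aux_inner]
    congr 1; ext t
    rw [mul_right_comm, ← Complex.exp_nat_mul, ← Complex.exp_add]
    congr 2; push_cast; ring
  simp only [h2] at h
  have h3 : ∀ t : ℝ, (Complex.exp (-(l : ℂ) * Complex.I * t) *
      Complex.exp ((x / 2 : ℝ) * Complex.exp (Complex.I * t))) *
        Complex.exp (-(x / 2 : ℝ) * Complex.exp (-Complex.I * t)) =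
      Complex.exp (-(l : ℂ) * Complex.I * t + x * Complex.sin t * Complex.I) := by
    intro t
    rw [← Complex.exp_add, ← Complex.exp_add, Complex.sin]
    congr 1
    push_cast
    rw [show -(t : ℂ) * Complex.I = -Complex.I * t by ring,
      show (t : ℂ) * Complex.I = Complex.I * t by ring]
    linear_combination (x * (Complex.exp (Complex.I * t) - Complex.exp (-Complex.I * t)) / 2) *
      Complex.I_sq
  simp only [h3] at h
  rw [← h.tsum_eq, besselJ, Complex.ofReal_tsum, ← tsum_mul_left]
  congr 1; ext n
  rw [show (n : ℝ) + l + 1 = ((n + l : ℕ) : ℝ) + 1 by push_cast; ring,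
    Real.Gamma_nat_eq_factorial,
    show 2 * (n : ℝ) + l = ((2 * n + l : ℕ) : ℝ) by push_cast; ring, Real.rpow_natCast]
  have e1 : (n.factorial : ℂ) ≠ 0 := by exact_mod_cast n.factorial_ne_zero
  have e2 : ((n + l).factorial : ℂ) ≠ 0 := by exact_mod_cast (n + l).factorial_ne_zero
  push_cast
  rw [neg_pow]
  field_simp
  ring

/-- integral representation -/
lemma bessel_int (l : ℕ) (x : ℝ) (hx : 0 < x) :
    π * besselJ l x = (∫ t in (0 : ℝ)..π, Complex.exp (((l * t - x * Real.sin t : ℝ) : ℂ) * Complex.I)).re := by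
  have h := bessel_complex l x hx
  set F : ℝ → ℂ := fun t => Complex.exp (((l * t - x * Real.sin t : ℝ) : ℂ) * Complex.I) with hF
  have hFc : Continuous F := by rw [hF]; fun_prop
  have hneg : ∀ t : ℝ, Complex.exp (-(l : ℂ) * Complex.I * t + x * Complex.sin t * Complex.I)
      = F (-t) := by
    intro t; simp only [hF]; congr 1; push_cast; simp; ring
  simp only [hneg] at h
  rw [intervalIntegral.integral_comp_neg (fun t => F t), neg_neg,
    ← intervalIntegral.integral_add_adjacent_intervals (b := 0)
      (hFc.intervalIntegrable _ _) (hFc.intervalIntegrable _ _)] at h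
  have h4 : (∫ t in (-π)..0, F t) = (starRingEnd ℂ) (∫ t in (0:ℝ)..π, F t) := by
    have h5 := intervalIntegral.integral_comp_neg (a := 0) (b := π) (fun t => F t)
    rw [neg_zero] at h5
    rw [← h5, intervalIntegral.integral_of_le pi_pos.le, intervalIntegral.integral_of_le pi_pos.le,
      ← integral_conj]
    congr 1; ext t
    simp only [hF, ← Complex.exp_conj, map_mul, Complex.conj_I, Complex.conj_ofReal]
    congr 1; push_cast; simp; ring
  rw [h4] at h
  have h6 := congrArg Complex.re h
  simp only [Complex.add_re, Complex.conj_re] at h6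
  rw [show (2 * (π:ℂ) * (besselJ l x : ℂ)) = ((2 * π * besselJ l x : ℝ) : ℂ) by push_cast; ring,
    Complex.ofReal_re] at h6
  linarith

lemma vdc (Φ dPhi ddPhi : ℝ → ℝ) (h1 : ∀ t, HasDerivAt Φ (dPhi t) t) (h2 : ∀ t, HasDerivAt dPhi (ddPhi t) t)
    (h3 : Continuous ddPhi) (a b : ℝ) (hab : a ≤ b) (hpos : ∀ t ∈ Icc a b, 0 ≤ ddPhi t)
    (lam : ℝ) (hlam : 0 < lam) (hl : ∀ t ∈ Icc a b, lam ≤ |dPhi t|) :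
    ‖∫ t in a..b, Complex.exp ((Φ t : ℂ) * Complex.I)‖ ≤ 4 / lam := by
  have hne : ∀ t ∈ Icc a b, dPhi t ≠ 0 := fun t ht h => by
    have := hl t ht; rw [h, abs_zero] at this; linarith
  have hc' : Continuous dPhi := continuous_iff_continuousAt.2 fun t => (h2 t).continuousAt
  have hc : Continuous Φ := continuous_iff_continuousAt.2 fun t => (h1 t).continuousAt
  have hU : uIcc a b = Icc a b := uIcc_of_le hab
  have hinv : ∀ t ∈ Icc a b, HasDerivAt (fun s => (dPhi s)⁻¹) (-ddPhi t / dPhi t ^ 2) t :=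
    fun t ht => (h2 t).inv (hne t ht)
  have hgc : ContinuousOn (fun t => -ddPhi t / dPhi t ^ 2) (uIcc a b) := by
    rw [hU]
    exact h3.neg.continuousOn.div (hc'.pow 2).continuousOn fun t ht => pow_ne_zero 2 (hne t ht)
  have hibp := intervalIntegral.integral_mul_deriv_eq_deriv_mul (a := a) (b := b)
    (u := fun t => (((dPhi t)⁻¹ : ℝ) : ℂ) * (-Complex.I))
    (v := fun t => Complex.exp ((Φ t : ℂ) * Complex.I))
    (u' := fun t => ((-ddPhi t / dPhi t ^ 2 : ℝ) : ℂ) * (-Complex.I))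
    (v' := fun t => Complex.exp ((Φ t : ℂ) * Complex.I) * ((dPhi t : ℂ) * Complex.I))
    (fun t ht => ((hinv t (hU ▸ ht)).ofReal_comp).mul_const _)
    (fun t ht => (((h1 t).ofReal_comp).mul_const _).cexp)
    (by
      apply ContinuousOn.intervalIntegrable
      exact (Complex.continuous_ofReal.comp_continuousOn hgc).mul continuousOn_const)
    (by
      apply Continuous.intervalIntegrable
      fun_prop)
  have hL : (∫ t in a..b, Complex.exp ((Φ t : ℂ) * Complex.I)) = ∫ t in a..b,
      ((((dPhi t)⁻¹ : ℝ) : ℂ) * (-Complex.I)) *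
        (Complex.exp ((Φ t : ℂ) * Complex.I) * ((dPhi t : ℂ) * Complex.I)) := by
    apply intervalIntegral.integral_congr
    intro t ht
    have : (dPhi t : ℂ) ≠ 0 := by exact_mod_cast hne t (hU ▸ ht)
    simp only []
    push_cast
    field_simp
    simp
  rw [hL, hibp]
  have hb : ∀ t ∈ Icc a b, |(dPhi t)⁻¹| ≤ 1 / lam := fun t ht => by
    rw [abs_inv, ← one_div]; exact one_div_le_one_div_of_le hlam (hl t ht)
  have hbd : ∀ t ∈ Icc a b, ‖((((dPhi t)⁻¹ : ℝ) : ℂ) * (-Complex.I)) *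
      Complex.exp ((Φ t : ℂ) * Complex.I)‖ ≤ 1 / lam := fun t ht => by
    rw [norm_mul, norm_mul, Complex.norm_exp_ofReal_mul_I, Complex.norm_real, norm_neg,
      Complex.norm_I, mul_one, mul_one]
    exact hb t ht
  have hint : ‖∫ t in a..b, (((-ddPhi t / dPhi t ^ 2 : ℝ) : ℂ) * (-Complex.I)) *
      Complex.exp ((Φ t : ℂ) * Complex.I)‖ ≤ ∫ t in a..b, -(-ddPhi t / dPhi t ^ 2) := by
    apply intervalIntegral.norm_integral_le_of_norm_le hab
    · refine Eventually.of_forall fun t ht => ?_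
      rw [norm_mul, norm_mul, Complex.norm_exp_ofReal_mul_I, Complex.norm_real, norm_neg,
        Complex.norm_I, mul_one, mul_one, Real.norm_eq_abs, neg_div, abs_neg, neg_neg, abs_of_nonneg]
      exact div_nonneg (hpos t ⟨ht.1.le, ht.2⟩) (sq_nonneg _)
    · exact (hgc.neg).intervalIntegrable
  rw [intervalIntegral.integral_neg, intervalIntegral.integral_eq_sub_of_hasDerivAt
    (fun t ht => hinv t (hU ▸ ht)) hgc.intervalIntegrable] at hint
  have ha' := abs_le.1 (hb a ⟨le_rfl, hab⟩)
  have hb' := abs_le.1 (hb b ⟨hab, le_rfl⟩)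
  have e1 := hbd a ⟨le_rfl, hab⟩
  have e2 := hbd b ⟨hab, le_rfl⟩
  have e3 : 4 / lam = 1 / lam + 1 / lam + (1 / lam + 1 / lam) := by ring
  rw [e3]
  refine (norm_sub_le _ _).trans (add_le_add ((norm_sub_le _ _).trans (add_le_add e2 e1)) ?_)
  linarith

lemma gauss_tail (b : ℂ) (hb : b ≠ 0) (hre : 0 ≤ b.re) (K M : ℝ) (hK : 0 < K) (hKM : K ≤ M) :
    ‖∫ t in K..M, Complex.exp (-b * (t : ℂ) ^ 2)‖ ≤ 1 / (‖b‖ * K) := by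
  have hU : uIcc K M = Icc K M := uIcc_of_le hKM
  have hpos : ∀ t ∈ uIcc K M, 0 < t := fun t ht => hK.trans_le (hU ▸ ht).1
  have hinv : ∀ t ∈ uIcc K M, HasDerivAt (fun s : ℝ => s⁻¹) (-(t ^ 2)⁻¹) t :=
    fun t ht => hasDerivAt_inv (hpos t ht).ne'
  have hgc : ContinuousOn (fun t : ℝ => -(t ^ 2)⁻¹) (uIcc K M) := by
    exact ((continuous_pow 2).continuousOn.inv₀ fun t ht => pow_ne_zero 2 (hpos t ht).ne').neg
  have hv : ∀ t : ℝ, HasDerivAt (fun t : ℝ => Complex.exp (-b * (t : ℂ) ^ 2))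
      (Complex.exp (-b * (t : ℂ) ^ 2) * (-b * (2 * t))) t := by
    intro t
    have h := ((hasDerivAt_id (t : ℂ)).pow 2).const_mul (-b)
    have h2 := (h.cexp).comp_ofReal
    simpa using h2
  have hibp := intervalIntegral.integral_mul_deriv_eq_deriv_mul (a := K) (b := M)
    (u := fun t : ℝ => ((t⁻¹ : ℝ) : ℂ) * (-2 * b)⁻¹)
    (v := fun t : ℝ => Complex.exp (-b * (t : ℂ) ^ 2))
    (u' := fun t : ℝ => ((-(t ^ 2)⁻¹ : ℝ) : ℂ) * (-2 * b)⁻¹)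
    (v' := fun t : ℝ => Complex.exp (-b * (t : ℂ) ^ 2) * (-b * (2 * t)))
    (fun t ht => ((hinv t ht).ofReal_comp).mul_const _)
    (fun t ht => hv t)
    (by
      apply ContinuousOn.intervalIntegrable
      exact (Complex.continuous_ofReal.comp_continuousOn hgc).mul continuousOn_const)
    (by
      apply Continuous.intervalIntegrable
      fun_prop)
  have hL : (∫ t in K..M, Complex.exp (-b * (t : ℂ) ^ 2)) = ∫ t in K..M,
      (((t⁻¹ : ℝ) : ℂ) * (-2 * b)⁻¹) * (Complex.exp (-b * (t : ℂ) ^ 2) * (-b * (2 * t))) := by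
    apply intervalIntegral.integral_congr
    intro t ht
    have : (t : ℂ) ≠ 0 := by exact_mod_cast (hpos t ht).ne'
    simp only []
    push_cast
    field_simp
  rw [hL, hibp]
  have hexp : ∀ t : ℝ, ‖Complex.exp (-b * (t : ℂ) ^ 2)‖ ≤ 1 := by
    intro t
    rw [Complex.norm_exp, Real.exp_le_one_iff, ← Complex.ofReal_pow, Complex.re_mul_ofReal]
    simp; positivity
  have hB : 0 < ‖b‖ := norm_pos_iff.2 hb
  have hbd : ∀ t ∈ uIcc K M, ‖((t⁻¹ : ℝ) : ℂ) * (-2 * b)⁻¹ * Complex.exp (-b * (t : ℂ) ^ 2)‖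
      ≤ t⁻¹ * (2 * ‖b‖)⁻¹ := fun t ht => by
    have := (hpos t ht)
    rw [norm_mul, norm_mul, Complex.norm_real, norm_inv, norm_inv, norm_mul, norm_neg,
      Complex.norm_two, Real.norm_of_nonneg this.le]
    exact mul_le_of_le_one_right (by positivity) (hexp t)
  have hint : ‖∫ t in K..M, (((-(t ^ 2)⁻¹ : ℝ) : ℂ) * (-2 * b)⁻¹) *
      Complex.exp (-b * (t : ℂ) ^ 2)‖ ≤ ∫ t in K..M, -(t ^ 2)⁻¹ * (-(2 * ‖b‖)⁻¹) := by
    apply intervalIntegral.norm_integral_le_of_norm_le hKM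
    · refine Eventually.of_forall fun t ht => ?_
      have := hK.trans ht.1
      rw [norm_mul, norm_mul, Complex.norm_real, norm_neg, norm_inv, norm_inv, norm_mul, norm_neg,
        Complex.norm_two, Real.norm_of_nonneg (sq_nonneg t), neg_mul_neg]
      exact mul_le_of_le_one_right (by positivity) (hexp t)
    · exact (hgc.mul continuousOn_const).intervalIntegrable
  rw [intervalIntegral.integral_mul_const, intervalIntegral.integral_eq_sub_of_hasDerivAt
    hinv hgc.intervalIntegrable] at hint
  have e1 := hbd K (by rw [hU]; exact ⟨le_rfl, hKM⟩)
  have e2 := hbd M (by rw [hU]; exact ⟨hKM, le_rfl⟩)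
  refine (norm_sub_le _ _).trans ((add_le_add ((norm_sub_le _ _).trans (add_le_add e2 e1)) hint).trans ?_)
  apply le_of_eq
  field_simp
  ring

lemma gauss_trunc (b : ℂ) (hre : 0 < b.re) (K : ℝ) (hK : 0 < K) :
    ‖(∫ t in (-K)..K, Complex.exp (-b * (t : ℂ) ^ 2)) - (π / b : ℂ) ^ (1 / 2 : ℂ)‖
      ≤ 2 / (‖b‖ * K) := by
  have hb : b ≠ 0 := by rintro rfl; simp at hre
  have hc : Continuous fun t : ℝ => Complex.exp (-b * (t : ℂ) ^ 2) := by fun_prop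
  have hI : ∀ x y : ℝ, IntervalIntegrable (fun t : ℝ => Complex.exp (-b * (t : ℂ) ^ 2))
    MeasureTheory.volume x y := fun x y => hc.intervalIntegrable x y
  have h := MeasureTheory.intervalIntegral_tendsto_integral (integrable_cexp_neg_mul_sq hre)
    tendsto_neg_atTop_atBot (tendsto_id (α := ℝ) (x := atTop))
  rw [integral_gaussian_complex hre] at h
  refine le_of_tendsto ((tendsto_const_nhds.sub h).norm) ?_
  filter_upwards [eventually_ge_atTop K] with M hM
  have hs : (∫ t in (-M)..(-K), Complex.exp (-b * (t : ℂ) ^ 2)) =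
      ∫ t in K..M, Complex.exp (-b * (t : ℂ) ^ 2) := by
    rw [← intervalIntegral.integral_comp_neg (fun t : ℝ => Complex.exp (-b * (t : ℂ) ^ 2))]
    simp
  have e1 := intervalIntegral.integral_add_adjacent_intervals (hI (-M) (-K)) (hI (-K) K)
  have e2 := intervalIntegral.integral_add_adjacent_intervals (hI (-M) K) (hI K M)
  simp only [id]
  rw [← e2, ← e1, hs]
  have ht := gauss_tail b hb hre.le K M hK hM
  have e3 : ∀ A B : ℂ, A - (B + A + B) = -(B + B) := fun A B => by ring
  rw [e3, norm_neg]
  refine (norm_add_le _ _).trans ((add_le_add ht ht).trans (le_of_eq ?_))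
  ring

lemma fresnel (κ : ℝ) (hκ : 0 < κ) (K : ℝ) (hK : 0 < K) :
    ‖(∫ t in (-K)..K, Complex.exp (((κ * t ^ 2 : ℝ) : ℂ) * Complex.I)) -
      (√(π / κ) : ℂ) * Complex.exp ((π / 4 : ℝ) * Complex.I)‖ ≤ 2 / (κ * K) := by
  have hval : (π / (-(κ * Complex.I)) : ℂ) ^ (1 / 2 : ℂ)
      = (√(π / κ) : ℂ) * Complex.exp ((π / 4 : ℝ) * Complex.I) := by
    have e : (π / (-(κ * Complex.I)) : ℂ) = ((π / κ : ℝ) : ℂ) * Complex.I := by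
      have : (κ : ℂ) ≠ 0 := by exact_mod_cast hκ.ne'
      push_cast; field_simp; simp
    have hpk : 0 < π / κ := by positivity
    have hne : ((π / κ : ℝ) : ℂ) * Complex.I ≠ 0 :=
      mul_ne_zero (by exact_mod_cast hpk.ne') Complex.I_ne_zero
    rw [e, Complex.cpow_def_of_ne_zero hne, Complex.log_ofReal_mul hpk Complex.I_ne_zero,
      Complex.log_I, Real.sqrt_eq_rpow, Real.rpow_def_of_pos hpk, Complex.ofReal_exp,
      ← Complex.exp_add]
    congr 1
    push_cast; ring
  rw [← hval]
  have hK' : Continuous fun e : ℝ => ∫ t in (-K)..K,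
      Complex.exp (-((e : ℂ) - κ * Complex.I) * (t : ℂ) ^ 2) := by
    apply intervalIntegral.continuous_parametric_intervalIntegral_of_continuous'
    fun_prop
  have h1 : Tendsto (fun e : ℝ => ∫ t in (-K)..K,
      Complex.exp (-((e : ℂ) - κ * Complex.I) * (t : ℂ) ^ 2)) (nhdsWithin 0 (Ioi 0))
      (nhds (∫ t in (-K)..K, Complex.exp (((κ * t ^ 2 : ℝ) : ℂ) * Complex.I))) := by
    have := (hK'.tendsto 0).mono_left (nhdsWithin_le_nhds (s := Ioi 0))
    convert this using 3
    ext t; congr 1; push_cast; ring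
  have hkI : (-(κ * Complex.I) : ℂ) ≠ 0 :=
    neg_ne_zero.2 (mul_ne_zero (by exact_mod_cast hκ.ne') Complex.I_ne_zero)
  have h20 : Tendsto (fun e : ℝ => (e : ℂ) - κ * Complex.I) (nhdsWithin 0 (Ioi 0))
      (nhds (-(κ * Complex.I))) := by
    have hc : Continuous (fun e : ℝ => (e : ℂ) - κ * Complex.I) := by fun_prop
    have := (hc.tendsto 0).mono_left (nhdsWithin_le_nhds (s := Ioi 0))
    simpa using this
  have h2 : Tendsto (fun e : ℝ => (π / ((e : ℂ) - κ * Complex.I) : ℂ) ^ (1 / 2 : ℂ))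
      (nhdsWithin 0 (Ioi 0)) (nhds ((π / (-(κ * Complex.I)) : ℂ) ^ (1 / 2 : ℂ))) := by
    refine Tendsto.cpow (tendsto_const_nhds.div h20 hkI) tendsto_const_nhds ?_
    have e : (π / (-(κ * Complex.I)) : ℂ) = ((π / κ : ℝ) : ℂ) * Complex.I := by
      have : (κ : ℂ) ≠ 0 := by exact_mod_cast hκ.ne'
      push_cast; field_simp; simp
    rw [e]
    right
    have hpk : 0 < π / κ := by positivity
    rw [Complex.im_ofReal_mul]
    simp; exact hκ.ne'
  refine le_of_tendsto ((h1.sub h2).norm) ?_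
  filter_upwards [self_mem_nhdsWithin] with e he
  have he' : 0 < e := he
  refine (gauss_trunc ((e : ℂ) - κ * Complex.I) (by simpa using he') K hK).trans ?_
  have hn : κ ≤ ‖(e : ℂ) - κ * Complex.I‖ := by
    refine le_trans ?_ (Complex.abs_im_le_norm _)
    simp [abs_of_pos hκ]
  gcongr

lemma lim_A (R : ℕ → ℝ) (hR : Tendsto R atTop atTop) (t : ℝ) :
    Tendsto (fun n => R n ^ 2 * (t / R n - sin (t / R n))) atTop (nhds 0) := by
  have h0 : Tendsto (fun n => t / R n) atTop (nhds 0) := hR.const_div_atTop t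
  have h1 : Tendsto (fun n => |t| ^ 3 / R n) atTop (nhds 0) := hR.const_div_atTop _
  refine squeeze_zero_norm' ?_ h1
  filter_upwards [hR.eventually_gt_atTop 0, h0.abs.eventually_le_const (by simp : |(0:ℝ)| < 1)] with n hn hb
  set h := t / R n with hh
  have ht : t = h * R n := by rw [hh]; field_simp
  have hs := abs_le.1 (sin_bound hb)
  have e5 : |h| ^ 5 ≤ |h| ^ 3 := pow_le_pow_of_le_one (abs_nonneg _) hb (by norm_num)
  have e3 := abs_le.1 (le_of_eq (abs_pow h 3))
  have h3 : 0 ≤ |h| ^ 3 := by positivity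
  have : |h - sin h| ≤ |h| ^ 3 := by rw [abs_le]; constructor <;> linarith
  rw [Real.norm_eq_abs, abs_mul, abs_of_nonneg (sq_nonneg _), ht, abs_mul, abs_of_pos hn,
    show (|h| * R n) ^ 3 / R n = R n ^ 2 * |h| ^ 3 by field_simp]
  gcongr

lemma lim_B (R : ℕ → ℝ) (hR : Tendsto R atTop atTop) (t : ℝ) :
    Tendsto (fun n => R n ^ 2 * (1 - cos (t / R n))) atTop (nhds (t ^ 2 / 2)) := by
  have h0 : Tendsto (fun n => t / R n) atTop (nhds 0) := hR.const_div_atTop t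
  have h1 : Tendsto (fun n => |t| ^ 3 / R n) atTop (nhds 0) := hR.const_div_atTop _
  rw [tendsto_iff_norm_sub_tendsto_zero]
  refine squeeze_zero' (Eventually.of_forall fun _ => norm_nonneg _) ?_ h1
  filter_upwards [hR.eventually_gt_atTop 0, h0.abs.eventually_le_const (by simp : |(0:ℝ)| < 1)] with n hn hb
  set h := t / R n with hh
  have ht : t = h * R n := by rw [hh]; field_simp
  have hs := abs_le.1 (cos_bound hb)
  have e5 : |h| ^ 4 ≤ |h| ^ 3 := pow_le_pow_of_le_one (abs_nonneg _) hb (by norm_num)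
  have h3 : 0 ≤ |h| ^ 3 := by positivity
  have : |(1 - cos h) - h ^ 2 / 2| ≤ |h| ^ 3 := by rw [abs_le]; constructor <;> linarith
  rw [Real.norm_eq_abs, ht, abs_mul, abs_of_pos hn,
    show (|h| * R n) ^ 3 / R n = R n ^ 2 * |h| ^ 3 by field_simp,
    show R n ^ 2 * (1 - cos h) - (h * R n) ^ 2 / 2 = R n ^ 2 * ((1 - cos h) - h ^ 2 / 2) by ring,
    abs_mul, abs_of_nonneg (sq_nonneg _)]
  gcongr

lemma lim_sin (R : ℕ → ℝ) (hR : Tendsto R atTop atTop) (t : ℝ) :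
    Tendsto (fun n => R n * sin (t / R n)) atTop (nhds t) := by
  have h := tendsto_const_nhds (x := t).sub ((lim_A R hR t).div_atTop hR)
  rw [sub_zero] at h
  refine h.congr' ?_
  filter_upwards [hR.eventually_gt_atTop 0] with n hn
  field_simp
  ring

/-- pointwise limit of the phase -/
lemma lim_phase (α β T : ℝ) (hc : α * cos β = 1) (hs : α * sin β = T) (R s : ℕ → ℝ)
    (hR : Tendsto R atTop atTop) (hs0 : Tendsto s atTop (nhds 0)) (t : ℝ) :
    Tendsto (fun n => R n ^ 2 * (β + t / R n) - (α * R n ^ 2 + s n) * sin (β + t / R n)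
      - R n ^ 2 * (β - T)) atTop (nhds (T / 2 * t ^ 2)) := by
  have h3 : Tendsto (fun n => s n * sin (β + t / R n)) atTop (nhds 0) := by
    refine squeeze_zero_norm (fun n => ?_) (by simpa using hs0.abs)
    rw [Real.norm_eq_abs, abs_mul]
    exact mul_le_of_le_one_right (abs_nonneg _) (abs_sin_le_one _)
  have h := ((lim_A R hR t).add ((lim_B R hR t).const_mul T)).sub h3
  rw [show 0 + T * (t ^ 2 / 2) - 0 = T / 2 * t ^ 2 by ring] at h
  refine h.congr fun n => ?_
  rw [sin_add]
  linear_combination (R n ^ 2 * cos (t / R n)) * hs + R n ^ 2 * sin (t / R n) * hc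

lemma lim_dphase (α β T : ℝ) (hc : α * cos β = 1) (hs : α * sin β = T) (R s : ℕ → ℝ)
    (hR : Tendsto R atTop atTop) (hs0 : Tendsto s atTop (nhds 0)) (t : ℝ) :
    Tendsto (fun n => (R n ^ 2 - (α * R n ^ 2 + s n) * cos (β + t / R n)) / R n)
      atTop (nhds (T * t)) := by
  have h3 : Tendsto (fun n => s n * cos (β + t / R n)) atTop (nhds 0) := by
    refine squeeze_zero_norm (fun n => ?_) (by simpa using hs0.abs)
    rw [Real.norm_eq_abs, abs_mul]
    exact mul_le_of_le_one_right (abs_nonneg _) (abs_cos_le_one _)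
  have h := (((lim_B R hR t).sub h3).div_atTop hR).add ((lim_sin R hR t).const_mul T)
  rw [zero_add] at h
  refine h.congr' ?_
  filter_upwards [hR.eventually_gt_atTop 0] with n hn
  rw [cos_add]
  field_simp
  linear_combination (-R n ^ 2 * sin (t / R n)) * hs + R n ^ 2 * cos (t / R n) * hc

lemma stat_phase (α β T : ℝ) (hα : 0 < α) (hT : 0 < T) (hβ0 : 0 < β) (hβ1 : β < π)
    (hc : α * cos β = 1) (hs : α * sin β = T) (R s : ℕ → ℝ)
    (hR : Tendsto R atTop atTop) (hs0 : Tendsto s atTop (nhds 0)) :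
    Tendsto (fun n => (R n : ℂ) * Complex.exp (((-(R n ^ 2 * (β - T)) : ℝ) : ℂ) * Complex.I) *
      ∫ θ in (0 : ℝ)..π, Complex.exp
        (((R n ^ 2 * θ - (α * R n ^ 2 + s n) * sin θ : ℝ) : ℂ) * Complex.I)) atTop
      (nhds ((√(π / (T / 2)) : ℂ) * Complex.exp ((π / 4 : ℝ) * Complex.I))) := by
  rw [Metric.tendsto_atTop']
  intro ε hε
  obtain ⟨K, hK, hKε⟩ : ∃ K : ℝ, 0 < K ∧ 20 / (T * K) < ε / 2 := by
    refine ⟨80 / (T * ε), by positivity, ?_⟩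
    rw [show 20 / (T * (80 / (T * ε))) = ε / 4 by field_simp; norm_num]
    linarith
  -- middle part
  have hmid : Tendsto (fun n => ∫ t in (-K)..K, Complex.exp
      (((R n ^ 2 * (β + t / R n) - (α * R n ^ 2 + s n) * sin (β + t / R n)
      - R n ^ 2 * (β - T) : ℝ) : ℂ) * Complex.I)) atTop
      (nhds (∫ t in (-K)..K, Complex.exp (((T / 2 * t ^ 2 : ℝ) : ℂ) * Complex.I))) := by
    apply intervalIntegral.tendsto_integral_filter_of_dominated_convergence (fun _ => (1 : ℝ))
    · refine Eventually.of_forall fun n => ?_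
      exact (by fun_prop : Continuous _).aestronglyMeasurable
    · refine Eventually.of_forall fun n => Eventually.of_forall fun t _ => ?_
      rw [Complex.norm_exp_ofReal_mul_I]
    · exact intervalIntegrable_const
    · refine Eventually.of_forall fun t _ => ?_
      have := lim_phase α β T hc hs R s hR hs0 t
      exact (((Complex.continuous_ofReal.tendsto _).comp this).mul_const _).cexp
  have hfr := fresnel (T / 2) (by positivity) K hK
  have hTK : 0 < T * K := by positivity
  have hd1 := (lim_dphase α β T hc hs R s hR hs0 K).eventually_const_le
    (show T * K / 2 < T * K by linarith)
  have hd2 := (lim_dphase α β T hc hs R s hR hs0 (-K)).eventually_le_const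
    (show T * (-K) < -(T * K / 2) by linarith)
  have hx : ∀ᶠ n in atTop, 0 ≤ α * R n ^ 2 + s n := by
    have h : Tendsto (fun n => α * R n ^ 2 + s n) atTop atTop :=
      (((tendsto_pow_atTop two_ne_zero).comp hR).const_mul_atTop hα).atTop_add hs0
    exact h.eventually_ge_atTop 0
  have hb1 : ∀ᶠ n in atTop, β + K / R n ≤ π := by
    have h : Tendsto (fun n => β + K / R n) atTop (nhds (β + 0)) :=
      (hR.const_div_atTop K).const_add β
    exact h.eventually_le_const (by simpa using hβ1)
  have hb2 : ∀ᶠ n in atTop, 0 ≤ β + -K / R n := by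
    have h : Tendsto (fun n => β + -K / R n) atTop (nhds (β + 0)) :=
      (hR.const_div_atTop (-K)).const_add β
    exact h.eventually_const_le (by simpa using hβ0)
  have hm := (Metric.tendsto_nhds.1 hmid) (ε / 2) (by positivity)
  have key : ∀ᶠ n in atTop, dist ((R n : ℂ) * Complex.exp (((-(R n ^ 2 * (β - T)) : ℝ) : ℂ) * Complex.I) *
      ∫ θ in (0 : ℝ)..π, Complex.exp
        (((R n ^ 2 * θ - (α * R n ^ 2 + s n) * sin θ : ℝ) : ℂ) * Complex.I))
      ((√(π / (T / 2)) : ℂ) * Complex.exp ((π / 4 : ℝ) * Complex.I)) < ε := by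
    filter_upwards [hd1, hd2, hx, hb1, hb2, hm, hR.eventually_gt_atTop 0] with n d1 d2 x0 b1 b2 m r0
    have hKR : 0 < K / R n := by positivity
    have hKR' : -K / R n < 0 := by rw [neg_div]; linarith
    set X := α * R n ^ 2 + s n with hX
    set N := R n ^ 2 with hN
    set F : ℝ → ℂ := fun θ => Complex.exp (((N * θ - X * sin θ : ℝ) : ℂ) * Complex.I) with hF
    have hFc : Continuous F := by rw [hF]; fun_prop
    have hvdc : ∀ a b : ℝ, 0 ≤ a → a ≤ b → b ≤ π →
        (∀ θ ∈ Icc a b, R n * (T * K / 2) ≤ |N - X * cos θ|) →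
        ‖∫ θ in a..b, F θ‖ ≤ 4 / (R n * (T * K / 2)) := by
      intro a b ha hab hb hl
      refine vdc (fun θ => N * θ - X * sin θ) (fun θ => N - X * cos θ) (fun θ => X * sin θ)
        (fun θ => ?_) (fun θ => ?_) (by fun_prop) a b hab ?_ _ (by positivity) hl
      · have h := ((hasDerivAt_id θ).const_mul N).sub ((hasDerivAt_sin θ).const_mul X)
        rw [mul_one] at h
        exact h
      · simpa using ((hasDerivAt_cos θ).const_mul X).const_sub N
      · intro θ hθ
        exact mul_nonneg x0 (sin_nonneg_of_nonneg_of_le_pi (ha.trans hθ.1) (hθ.2.trans hb))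
    have t1 := hvdc (β + K / R n) π (by linarith) b1 le_rfl (fun θ hθ => by
      refine le_trans ?_ (le_abs_self _)
      rw [le_div_iff₀ r0] at d1
      have : cos θ ≤ cos (β + K / R n) :=
        cos_le_cos_of_nonneg_of_le_pi (by linarith) hθ.2 hθ.1
      have := mul_le_mul_of_nonneg_left this x0
      linarith)
    have t2 := hvdc 0 (β + -K / R n) le_rfl b2 (by linarith) (fun θ hθ => by
      refine le_trans ?_ (neg_le_abs _)
      rw [div_le_iff₀ r0] at d2
      have : cos (β + -K / R n) ≤ cos θ :=
        cos_le_cos_of_nonneg_of_le_pi hθ.1 (by linarith) hθ.2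
      have := mul_le_mul_of_nonneg_left this x0
      linarith)
    set E : ℂ := Complex.exp (((-(N * (β - T)) : ℝ) : ℂ) * Complex.I) with hE
    have hEn : ‖E‖ = 1 := Complex.norm_exp_ofReal_mul_I _
    have hsplit : (∫ θ in (0 : ℝ)..π, F θ) = (∫ θ in (0 : ℝ)..(β + -K / R n), F θ) +
        (∫ θ in (β + -K / R n)..(β + K / R n), F θ) + ∫ θ in (β + K / R n)..π, F θ := by
      rw [intervalIntegral.integral_add_adjacent_intervals (hFc.intervalIntegrable _ _)
        (hFc.intervalIntegrable _ _), intervalIntegral.integral_add_adjacent_intervals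
        (hFc.intervalIntegrable _ _) (hFc.intervalIntegrable _ _)]
    have hM : (∫ t in (-K)..K, Complex.exp (((N * (β + t / R n) - X * sin (β + t / R n)
      - N * (β - T) : ℝ) : ℂ) * Complex.I)) =
        R n * E * ∫ θ in (β + -K / R n)..(β + K / R n), F θ := by
      have h := intervalIntegral.integral_comp_add_div (a := -K) (b := K) F r0.ne' β
      rw [mul_comm (R n : ℂ) E, mul_assoc, ← Complex.real_smul (x := R n), ← h,
        ← intervalIntegral.integral_const_mul]
      congr 1; ext t
      rw [hE, hF, ← Complex.exp_add]
      congr 1; push_cast; ring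
    rw [hM] at m
    rw [hsplit, dist_eq_norm]
    rw [dist_eq_norm] at m
    set A := ∫ θ in (0 : ℝ)..(β + -K / R n), F θ
    set B := ∫ θ in (β + -K / R n)..(β + K / R n), F θ
    set C := ∫ θ in (β + K / R n)..π, F θ
    set G := ∫ t in (-K)..K, Complex.exp (((T / 2 * t ^ 2 : ℝ) : ℂ) * Complex.I)
    set H := (√(π / (T / 2)) : ℂ) * Complex.exp ((π / 4 : ℝ) * Complex.I)
    have hRE : ‖(R n : ℂ) * E‖ = R n := by
      rw [norm_mul, hEn, mul_one, Complex.norm_real, Real.norm_of_nonneg r0.le]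
    have e1 : ‖(R n : ℂ) * E * A‖ ≤ 8 / (T * K) := by
      rw [norm_mul, hRE]
      calc R n * ‖A‖ ≤ R n * (4 / (R n * (T * K / 2))) := by gcongr
        _ = 8 / (T * K) := by field_simp; norm_num
    have e2 : ‖(R n : ℂ) * E * C‖ ≤ 8 / (T * K) := by
      rw [norm_mul, hRE]
      calc R n * ‖C‖ ≤ R n * (4 / (R n * (T * K / 2))) := by gcongr
        _ = 8 / (T * K) := by field_simp; norm_num
    have e3 : 2 / (T / 2 * K) = 4 / (T * K) := by field_simp; norm_num
    rw [e3] at hfr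
    have e4 : (R n : ℂ) * E * (A + B + C) - H =
        R n * E * A + (R n * E * B - G) + (R n * E * C) + (G - H) := by ring
    rw [e4]
    have e5 : 20 / (T * K) = 8 / (T * K) + 8 / (T * K) + 4 / (T * K) := by ring
    have n1 := norm_add_le (R n * E * A + (R n * E * B - G) + (R n * E * C)) (G - H)
    have n2 := norm_add_le (R n * E * A + (R n * E * B - G)) (R n * E * C)
    have n3 := norm_add_le (R n * E * A) (R n * E * B - G)
    linarith
  obtain ⟨N, hN⟩ := eventually_atTop.1 key
  exact ⟨N, fun n hn => hN n hn.le⟩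

lemma cos_lower (p q : ℕ) (hp : 0 < p) (hcop : Nat.Coprime p q)
    (hcond : ¬(4 ∣ p) ∨ 2 ∣ q) :
    ∃ d : ℝ, 0 < d ∧ ∀ l : ℕ, d ≤ |cos ((l : ℝ) * (-(π * q / p)) + π / 4)| := by
  have hp' : (p : ℝ) ≠ 0 := by exact_mod_cast hp.ne'
  have h4 : ¬ (4 ∣ p) := by
    rcases hcond with h | h
    · exact h
    · intro h4
      have h2 : 2 ∣ p := Dvd.dvd.trans (by norm_num) h4
      have := Nat.dvd_gcd h2 h
      rw [hcop] at this
      omega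
  have hne : ∀ l : ℕ, cos ((l : ℝ) * (-(π * q / p)) + π / 4) ≠ 0 := by
    intro l h0
    obtain ⟨k, hk⟩ := Real.cos_eq_zero_iff.1 h0
    have e : (p : ℝ) * (-4 * k - 1) = 4 * (l * q) := by
      field_simp at hk
      linarith
    have e' : (p : ℤ) * (-4 * k - 1) = 4 * (l * q) := by exact_mod_cast e
    have h5 : (4 : ℤ) ∣ p := ⟨-(l * q) - k * p, by linarith⟩
    exact h4 (by exact_mod_cast h5)
  obtain ⟨m, -, hm⟩ := Finset.exists_min_image (Finset.range p)
    (fun l : ℕ => |cos ((l : ℝ) * (-(π * q / p)) + π / 4)|) ⟨0, by simpa using hp⟩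
  refine ⟨_, abs_pos.2 (hne m), fun l => ?_⟩
  have h := hm (l % p) (by simpa using Nat.mod_lt l hp)
  refine h.trans (le_of_eq ?_)
  have e : (l : ℝ) * (-(π * q / p)) + π / 4 =
      (((l % p : ℕ) : ℝ) * (-(π * q / p)) + π / 4) - ((l / p * q : ℕ) : ℝ) * π := by
    have : (l : ℝ) = (p : ℝ) * ((l / p : ℕ) : ℝ) + ((l % p : ℕ) : ℝ) := by
      exact_mod_cast (Nat.div_add_mod l p).symm
    rw [this]
    push_cast
    field_simp
    ring
  rw [e, Real.cos_sub_nat_mul_pi, abs_mul, abs_pow, abs_neg, abs_one, one_pow, one_mul]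

lemma no_close (α : ℝ) (hα : 1 < α)
    (p q : ℕ) (hp : 0 < p) (hq : 0 < q) (hcop : Nat.Coprime p q)
    (hpq : sigmaF α = (p:ℝ)/q)
    (hcond : ¬(4 ∣ p) ∨ 2 ∣ q) :
    ∃ δ : ℝ, 0 < δ ∧ ∃ L : ℕ, ∀ l : ℕ, L ≤ l → ∀ x : ℝ, 0 < x → besselJ l x = 0 →
      δ ≤ |x - α * l| := by
  have hp' : (0 : ℝ) < p := by exact_mod_cast hp
  have hq' : (0 : ℝ) < q := by exact_mod_cast hq
  have hα0 : 0 < α := by linarith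
  set T := √(α ^ 2 - 1) with hTdef
  set β := arccos (1 / α) with hβdef
  have hT : 0 < T := Real.sqrt_pos.2 (by nlinarith)
  have h1α : 1 / α < 1 := by rw [div_lt_one hα0]; exact hα
  have h0α : 0 < 1 / α := by positivity
  have hβ0 : 0 < β := arccos_pos.2 h1α
  have hβ1 : β < π := by
    have : β ≤ π / 2 := arccos_le_pi_div_two.2 h0α.le
    linarith [pi_pos]
  have hc : α * cos β = 1 := by
    rw [hβdef, cos_arccos (by linarith) h1α.le]; field_simp
  have hs : α * sin β = T := by
    rw [hβdef, sin_arccos, hTdef, show α ^ 2 - 1 = α ^ 2 * (1 - (1 / α) ^ 2) by field_simp,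
      Real.sqrt_mul (sq_nonneg α), Real.sqrt_sq hα0.le]
  have hTβ : β - T = -(π * q / p) := by
    have h : π / (T - β) = p / q := hpq
    have hne : T - β ≠ 0 := by
      intro h0
      rw [h0, div_zero] at h
      have : (0 : ℝ) < p / q := by positivity
      linarith
    field_simp at h ⊢
    linarith
  obtain ⟨d, hd, hcos⟩ := cos_lower p q hp hcop hcond
  by_contra hcon
  push Not at hcon
  have hseq : ∀ n : ℕ, ∃ l : ℕ, n ≤ l ∧ ∃ x : ℝ, 0 < x ∧ besselJ l x = 0 ∧
      |x - α * l| < 1 / ((n : ℝ) + 1) :=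
    fun n => hcon (1 / ((n : ℝ) + 1)) (by positivity) n
  choose l hl x hx hJ hclose using hseq
  set R : ℕ → ℝ := fun n => √(l n) with hRdef
  have hR2 : ∀ n, R n ^ 2 = l n := fun n => Real.sq_sqrt (Nat.cast_nonneg _)
  have hR : Tendsto R atTop atTop := by
    have h1 : Tendsto l atTop atTop := tendsto_atTop_mono hl tendsto_id
    exact Real.tendsto_sqrt_atTop.comp (tendsto_natCast_atTop_atTop.comp h1)
  have hs0 : Tendsto (fun n => x n - α * l n) atTop (nhds 0) :=
    squeeze_zero_norm (fun n => (hclose n).le) tendsto_one_div_add_atTop_nhds_zero_nat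
  have hmain := stat_phase α β T hα0 hT hβ0 hβ1 hc hs R _ hR hs0
  set F : ℝ := √(π / (T / 2)) with hF
  have hFpos : 0 < F := Real.sqrt_pos.2 (by have := pi_pos; positivity)
  obtain ⟨n, hn⟩ := ((Metric.tendsto_nhds.1 hmain) (F * d) (by positivity)).exists
  rw [dist_eq_norm] at hn
  have hint := bessel_int (l n) (x n) (hx n)
  rw [hJ n, mul_zero] at hint
  rw [hR2 n, show α * (l n : ℝ) + (x n - α * l n) = x n by ring] at hn
  set I := ∫ t in (0 : ℝ)..π, Complex.exp (((l n * t - x n * Real.sin t : ℝ) : ℂ) * Complex.I)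
  set ψ : ℝ := l n * (β - T) with hψ
  have hre : |(Complex.exp ((ψ : ℂ) * Complex.I) * ((R n : ℂ) *
      Complex.exp (((-ψ : ℝ) : ℂ) * Complex.I) * I - (F : ℂ) *
        Complex.exp ((π / 4 : ℝ) * Complex.I))).re| < F * d := by
    refine (Complex.abs_re_le_norm _).trans_lt ?_
    rw [norm_mul, Complex.norm_exp_ofReal_mul_I, one_mul]
    exact hn
  have e : Complex.exp ((ψ : ℂ) * Complex.I) * ((R n : ℂ) *
      Complex.exp (((-ψ : ℝ) : ℂ) * Complex.I) * I - (F : ℂ) *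
        Complex.exp ((π / 4 : ℝ) * Complex.I)) =
      (R n : ℂ) * I - (F : ℂ) * Complex.exp (((ψ + π / 4 : ℝ) : ℂ) * Complex.I) := by
    have e1 : Complex.exp ((ψ : ℂ) * Complex.I) * Complex.exp (((-ψ : ℝ) : ℂ) * Complex.I) = 1 := by
      rw [← Complex.exp_add, ← Complex.exp_zero]; congr 1; push_cast; ring
    have e2 : Complex.exp (((ψ + π / 4 : ℝ) : ℂ) * Complex.I) =
        Complex.exp ((ψ : ℂ) * Complex.I) * Complex.exp ((π / 4 : ℝ) * Complex.I) := by
      rw [← Complex.exp_add]; congr 1; push_cast; ring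
    rw [e2]
    linear_combination (R n : ℂ) * I * e1
  rw [e, Complex.sub_re, Complex.re_ofReal_mul, Complex.re_ofReal_mul, ← hint,
    Complex.exp_ofReal_mul_I_re, mul_zero, zero_sub, abs_neg, abs_mul, abs_of_pos hFpos] at hre
  have h2 := hcos (l n)
  rw [← hTβ] at h2
  have := mul_le_mul_of_nonneg_left h2 hFpos.le
  linarith

lemma bessel_cont (l : ℕ) (x : ℝ) (hx : 0 < x) : ContinuousAt (besselJ l) x := by
  have hc : Continuous fun x : ℝ => (∫ t in (0 : ℝ)..π,
      Complex.exp (((l * t - x * Real.sin t : ℝ) : ℂ) * Complex.I)).re / π := by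
    refine (Complex.continuous_re.comp ?_).div_const _
    apply intervalIntegral.continuous_parametric_intervalIntegral_of_continuous'
    fun_prop
  refine hc.continuousAt.congr ?_
  filter_upwards [lt_mem_nhds hx] with y hy
  rw [← bessel_int l y hy]
  field_simp

lemma fin_min (P : ℕ → ℝ → Prop) (h1 : ∀ k, ∃ c : ℝ, 0 < c ∧ P k c)
    (h2 : ∀ k c c', c' ≤ c → P k c → P k c') (n : ℕ) :
    ∃ c : ℝ, 0 < c ∧ ∀ k < n, P k c := by
  induction n with
  | zero => exact ⟨1, one_pos, fun k hk => absurd hk (Nat.not_lt_zero k)⟩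
  | succ n ih =>
    obtain ⟨c, hc, h⟩ := ih
    obtain ⟨c', hc', h'⟩ := h1 n
    refine ⟨min c c', lt_min hc hc', fun k hk => ?_⟩
    rcases Nat.lt_succ_iff_lt_or_eq.1 hk with hk | rfl
    · exact h2 _ _ _ (min_le_left _ _) (h k hk)
    · exact h2 _ _ _ (min_le_right _ _) h'

lemma fixed_l (l : ℕ) (u : ℕ → ℝ) (hpos : ∀ k, 1 ≤ k → 0 < u k)
    (hmono : ∀ k m, 1 ≤ k → k < m → u k < u m)
    (hzero : ∀ k, 1 ≤ k → besselJ l (u k) = 0)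
    (hall : ∀ z : ℝ, 0 < z → besselJ l z = 0 → ∃ k, 1 ≤ k ∧ u k = z) (A : ℝ) (hA : 0 ≤ A) :
    ∃ c : ℝ, 0 < c ∧ ∀ k, 1 ≤ k → u k ^ 2 - A ^ 2 = 0 ∨ c * u k ≤ |u k ^ 2 - A ^ 2| := by
  have hunb : ∃ k, 1 ≤ k ∧ A + 1 < u k := by
    by_contra hcon
    push Not at hcon
    have hm : Monotone fun k => u (k + 1) :=
      monotone_nat_of_le_succ fun k => (hmono _ _ (by omega) (by omega)).le
    have hb : BddAbove (range fun k => u (k + 1)) := by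
      refine ⟨A + 1, ?_⟩
      rintro _ ⟨k, rfl⟩
      exact hcon _ (by omega)
    have ht := tendsto_atTop_ciSup hm hb
    have hle : ∀ k, u (k + 1) ≤ ⨆ k, u (k + 1) := fun k => le_ciSup hb k
    set L := ⨆ k, u (k + 1)
    have hL : 0 < L := (hpos 1 le_rfl).trans_le (hle 0)
    have h0 := (bessel_cont l L hL).tendsto.comp ht
    have hz : besselJ l L = 0 := by
      refine tendsto_nhds_unique h0 ?_
      refine tendsto_const_nhds.congr fun k => ?_
      exact (hzero _ (by omega)).symm
    obtain ⟨k, hk, hkL⟩ := hall L hL hz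
    have := hmono k (k + 1) hk (by omega)
    have := hle k
    linarith
  obtain ⟨k0, hk0, hk0A⟩ := hunb
  obtain ⟨c, hc, h⟩ := fin_min
    (fun k c => 1 ≤ k → u k ^ 2 - A ^ 2 = 0 ∨ c * u k ≤ |u k ^ 2 - A ^ 2|)
    (fun k => by
      by_cases hk : 1 ≤ k
      · by_cases h0 : u k ^ 2 - A ^ 2 = 0
        · exact ⟨1, one_pos, fun _ => Or.inl h0⟩
        · refine ⟨|u k ^ 2 - A ^ 2| / u k, div_pos (abs_pos.2 h0) (hpos k hk), fun _ => Or.inr ?_⟩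
          rw [div_mul_cancel₀ _ (hpos k hk).ne']
      · exact ⟨1, one_pos, fun h => absurd h hk⟩)
    (fun k c c' hcc h hk => by
      rcases h hk with h | h
      · exact Or.inl h
      · exact Or.inr ((mul_le_mul_of_nonneg_right hcc (hpos k hk).le).trans h)) k0
  refine ⟨min c 1, lt_min hc one_pos, fun k hk => ?_⟩
  have hu := hpos k hk
  rcases lt_or_ge k k0 with hlt | hge
  · rcases h k hlt hk with h | h
    · exact Or.inl h
    · exact Or.inr ((mul_le_mul_of_nonneg_right (min_le_left _ _) hu.le).trans h)
  · right
    have hku : A + 1 < u k := by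
      rcases hge.eq_or_lt with rfl | hlt
      · exact hk0A
      · exact hk0A.trans (hmono k0 k hk0 hlt)
    refine (mul_le_mul_of_nonneg_right (min_le_right _ _) hu.le).trans ?_
    refine le_trans ?_ (le_abs_self _)
    nlinarith

theorem stmt_13 (α : ℝ) (hα : 1 < α)
    (p q : ℕ) (hp : 0 < p) (hq : 0 < q) (hcop : Nat.Coprime p q)
    (hpq : sigmaF α = (p:ℝ)/q)
    (hcond : ¬(4 ∣ p) ∨ 2 ∣ q)
    (J : ℝ → ℕ → ℝ)
    (hJpos : ∀ ν : ℝ, 0 ≤ ν → ∀ k : ℕ, 1 ≤ k → 0 < J ν k)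
    (hJmono : ∀ ν : ℝ, 0 ≤ ν → ∀ k l : ℕ, 1 ≤ k → k < l → J ν k < J ν l)
    (hJzero : ∀ ν : ℝ, 0 ≤ ν → ∀ k : ℕ, 1 ≤ k → besselJ ν (J ν k) = 0)
    (hJall : ∀ ν : ℝ, 0 ≤ ν → ∀ z : ℝ, 0 < z → besselJ ν z = 0 →
      ∃ k : ℕ, 1 ≤ k ∧ J ν k = z)
    : ∃ c : ℝ, 0 < c ∧ ∀ ℓ : ℕ, ∀ k : ℕ, 1 ≤ k →
        (J ℓ k)^2 - α^2*(ℓ:ℝ)^2 = 0 ∨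
        c * J ℓ k ≤ |(J ℓ k)^2 - α^2*(ℓ:ℝ)^2| := by
  have hα0 : 0 < α := by linarith
  have hn : ∀ l : ℕ, (0 : ℝ) ≤ l := fun l => Nat.cast_nonneg l
  obtain ⟨δ, hδ, L, hL⟩ := no_close α hα p q hp hq hcop hpq hcond
  obtain ⟨c, hc, h⟩ := fin_min
    (fun l c => ∀ k : ℕ, 1 ≤ k → (J l k)^2 - α^2*(l:ℝ)^2 = 0 ∨
        c * J l k ≤ |(J l k)^2 - α^2*(l:ℝ)^2|)
    (fun l => by
      have := fixed_l l (J l) (hJpos l (hn l)) (hJmono l (hn l)) (hJzero l (hn l))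
        (hJall l (hn l)) (α * l) (mul_nonneg hα0.le (hn l))
      simpa only [mul_pow] using this)
    (fun l c c' hcc h k hk => by
      rcases h k hk with h | h
      · exact Or.inl h
      · exact Or.inr ((mul_le_mul_of_nonneg_right hcc (hJpos l (hn l) k hk).le).trans h)) L
  refine ⟨min c δ, lt_min hc hδ, fun l k hk => ?_⟩
  have hu := hJpos l (hn l) k hk
  rcases lt_or_ge l L with hlt | hge
  · rcases h l hlt k hk with h | h
    · exact Or.inl h
    · exact Or.inr ((mul_le_mul_of_nonneg_right (min_le_left _ _) hu.le).trans h)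
  · right
    have h1 := hL l hge (J l k) hu (hJzero l (hn l) k hk)
    refine (mul_le_mul_of_nonneg_right (min_le_right _ _) hu.le).trans ?_
    have hAl : 0 ≤ α * l := mul_nonneg hα0.le (hn l)
    rw [show (J l k)^2 - α^2*(l:ℝ)^2 = (J l k - α * l) * (J l k + α * l) by ring, abs_mul,
      abs_of_pos (show 0 < J l k + α * l by linarith)]
    exact mul_le_mul h1 (by linarith) hu.le (abs_nonneg _)
end

section
/- Let α > 1 be such that σ(α) is rational, and write σ(α) = p/q with p, q ∈ ℕ coprime. Assume that 4 does not divide p or that q is even. Then the set Σ = { j_{ℓ,k}² − α²ℓ² : ℓ ∈ ℕ₀, k ∈ ℕ } has no finite accumulation points in ℝ, and for every Λ ∈ ℝ the set of pairs (ℓ,k) ∈ ℕ₀ × ℕ with j_{ℓ,k}² − α²ℓ² = Λ is finite. -/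
open Real Set Filter

theorem aux_exp1 (u : ℂ) : HasSum (fun j : ℕ => u ^ j / (j.factorial : ℂ)) (Complex.exp u) := by
    rw [Complex.exp_eq_exp_ℂ]
    exact NormedSpace.expSeries_div_hasSum_exp u

theorem aux_n1 (u : ℂ) : Summable (fun j : ℕ => ‖u ^ j / (j.factorial : ℂ)‖) := by
    simpa using Real.summable_pow_div_factorial ‖u‖

theorem aux_mul_gen (f g : ℕ → ℂ) (a b : ℂ) (hf : HasSum f a) (hg : HasSum g b)
   (hf' : Summable (fun j => ‖f j‖)) (hg' : Summable (fun j => ‖g j‖)) :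
    HasSum (fun jm : ℕ × ℕ => f jm.1 * g jm.2) (a * b) :=
  HasSum.mul hf hg (summable_mul_of_summable_norm hf' hg')

theorem aux_exp_mul (u v : ℂ) :
    HasSum (fun jm : ℕ × ℕ => u ^ jm.1 / (jm.1.factorial : ℂ) * (v ^ jm.2 / (jm.2.factorial : ℂ)))
      (Complex.exp u * Complex.exp v) := by
  have := aux_mul_gen _ _ _ _ (aux_exp1 u) (aux_exp1 v) (aux_n1 u) (aux_n1 v)
  simpa only using this

theorem aux_int_exp (k : ℤ) :
    (∫ θ in (-π)..π, Complex.exp (Complex.I * k * θ)) = if k = 0 then (2 * π : ℂ) else 0 := by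
  split_ifs with h
  · subst h
    simp
    ring
  · have hk : Complex.I * (k:ℂ) ≠ 0 := mul_ne_zero Complex.I_ne_zero (by exact_mod_cast h)
    rw [integral_exp_mul_complex hk]
    have : Complex.exp (Complex.I * k * (π:ℝ)) = Complex.exp (Complex.I * k * ((-π:ℝ))) := by
      rw [Complex.exp_eq_exp_iff_exists_int]
      refine ⟨k, ?_⟩
      push_cast
      ring
    rw [this]
    simp

theorem aux_term (x : ℝ) (n j m : ℕ) :
    (∫ θ in (-π)..π, ((x/2 : ℂ) * Complex.exp (Complex.I * (θ:ℝ)))^j / (j.factorial : ℂ) *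
      ((-x/2 : ℂ) * Complex.exp (-Complex.I * (θ:ℝ)))^m / (m.factorial : ℂ) *
      Complex.exp (-Complex.I * n * (θ:ℝ))) =
    if j = m + n then (2 * π : ℂ) * ((x/2)^j / (j.factorial : ℂ) * ((-x/2)^m / (m.factorial : ℂ))) else 0 := by
  have h : ∀ θ : ℝ, ((x/2 : ℂ) * Complex.exp (Complex.I * (θ:ℝ)))^j / (j.factorial : ℂ) *
      ((-x/2 : ℂ) * Complex.exp (-Complex.I * (θ:ℝ)))^m / (m.factorial : ℂ) *
      Complex.exp (-Complex.I * n * (θ:ℝ)) = ((x/2)^j / (j.factorial : ℂ) * ((-x/2)^m / (m.factorial : ℂ))) *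
        Complex.exp (Complex.I * (((j:ℤ) - m - n : ℤ) : ℂ) * θ) := by
    intro θ
    have : Complex.exp (Complex.I * (((j:ℤ) - m - n : ℤ) : ℂ) * θ) =
        Complex.exp (Complex.I * (θ:ℝ)) ^ j * Complex.exp (-Complex.I * (θ:ℝ)) ^ m *
        Complex.exp (-Complex.I * n * (θ:ℝ)) := by
      rw [← Complex.exp_nat_mul, ← Complex.exp_nat_mul, ← Complex.exp_add, ← Complex.exp_add]
      congr 1
      push_cast
      ring
    rw [this, mul_pow, mul_pow]
    ring
  simp_rw [h]
  rw [intervalIntegral.integral_const_mul, aux_int_exp]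
  by_cases hj : j = m + n
  · subst hj
    simp
    ring
  · rw [if_neg hj, if_neg (by omega), mul_zero]

theorem aux_hasSum_s14 (x : ℝ) (n : ℕ) :
    HasSum (fun jm : ℕ × ℕ => if jm.1 = jm.2 + n then
      (2 * π : ℂ) * ((x/2)^jm.1 / (jm.1.factorial : ℂ) * ((-x/2)^jm.2 / (jm.2.factorial : ℂ))) else 0)
    (∫ θ in (-π)..π, Complex.exp (Complex.I * (x * Real.sin θ - n * θ : ℝ))) := by
  simp_rw [← aux_term]
  have hs : Summable (fun j : ℕ => |x/2| ^ j / (j.factorial : ℝ)) :=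
    Real.summable_pow_div_factorial _
  have hs2 : Summable (fun jm : ℕ × ℕ => |x/2| ^ jm.1 / (jm.1.factorial : ℝ) *
      (|x/2| ^ jm.2 / (jm.2.factorial : ℝ))) :=
    hs.mul_of_nonneg hs (fun _ => by positivity) (fun _ => by positivity)
  refine intervalIntegral.hasSum_integral_of_dominated_convergence
    (fun jm _ => |x/2| ^ jm.1 / (jm.1.factorial : ℝ) * (|x/2| ^ jm.2 / (jm.2.factorial : ℝ)))
    ?_ ?_ ?_ ?_ ?_
  · intro jm
    apply Continuous.aestronglyMeasurable
    fun_prop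
  · intro jm
    refine Eventually.of_forall fun θ _ => ?_
    have e1 : ‖Complex.exp (Complex.I * (θ:ℝ))‖ = 1 := by
      rw [mul_comm]; exact Complex.norm_exp_ofReal_mul_I θ
    have e2 : ‖Complex.exp (-Complex.I * (θ:ℝ))‖ = 1 := by
      have := Complex.norm_exp_ofReal_mul_I (-θ)
      rw [← this]; congr 2; push_cast; ring
    have e3 : ‖Complex.exp (-Complex.I * n * (θ:ℝ))‖ = 1 := by
      have := Complex.norm_exp_ofReal_mul_I (-(n * θ))
      rw [← this]; congr 2; push_cast; ring
    have e4 : ‖(x/2 : ℂ)‖ = |x/2| := by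
      rw [← Real.norm_eq_abs, ← Complex.norm_real]; push_cast; rfl
    have e5 : ‖(-x/2 : ℂ)‖ = |x/2| := by
      rw [neg_div, norm_neg, e4]
    simp only [norm_mul, norm_div, norm_pow, e1, e2, e3, e4, e5, Complex.norm_natCast]
    apply le_of_eq
    ring
  · exact Eventually.of_forall fun θ _ => hs2
  · exact continuous_const.intervalIntegrable _ _
  · refine Eventually.of_forall fun θ _ => ?_
    have h3 := aux_exp_mul ((x/2 : ℂ) * Complex.exp (Complex.I * (θ:ℝ)))
      ((-x/2 : ℂ) * Complex.exp (-Complex.I * (θ:ℝ)))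
    have h4 := h3.mul_right (Complex.exp (-Complex.I * n * (θ:ℝ)))
    rw [← Complex.exp_add, ← Complex.exp_add] at h4
    have e : Complex.exp (Complex.I * (x * Real.sin θ - n * θ : ℝ)) =
        Complex.exp (x / 2 * Complex.exp (Complex.I * θ) + -x / 2 * Complex.exp (-Complex.I * θ)
          + -Complex.I * n * θ) := by
      congr 1
      push_cast
      have h2 := Complex.two_sin (θ:ℂ)
      have : Complex.I * Complex.I = -1 := Complex.I_mul_I
      rw [show -(θ:ℂ) * Complex.I = -Complex.I * θ by ring,
        show (θ:ℂ) * Complex.I = Complex.I * θ by ring] at h2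
      linear_combination (x/2) * (Complex.exp (-Complex.I * θ) - Complex.exp (Complex.I * θ)) * this +
        Complex.I * (x/2) * h2
    rw [e]
    exact h4.congr_fun (fun jm => by ring)

theorem besselJ_integral (n : ℕ) (x : ℝ) (hx : 0 < x) :
    besselJ n x = 1 / π * ∫ θ in (0:ℝ)..π, Real.cos (x * Real.sin θ - n * θ) := by
  have hs := aux_hasSum_s14 x n
  have hinj : Function.Injective (fun m : ℕ => ((m + n, m) : ℕ × ℕ)) := by
    intro a b h
    simpa using (congrArg Prod.snd h)
  rw [← hinj.hasSum_iff] at hs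
  swap
  · rintro ⟨j, m⟩ h
    rw [if_neg]
    rintro h'
    exact h ⟨m, by simp at h'; simp [h']⟩
  have hre : (∫ θ in (-π)..π, Complex.exp (Complex.I * (x * Real.sin θ - n * θ : ℝ))).re =
      ∫ θ in (-π)..π, Real.cos (x * Real.sin θ - n * θ) := by
    have := Complex.reCLM.intervalIntegral_comp_comm (μ := MeasureTheory.volume) (a := -π) (b := π)
      (f := fun θ : ℝ => Complex.exp (Complex.I * (x * Real.sin θ - n * θ : ℝ)))
      (Continuous.intervalIntegrable (by fun_prop) _ _)
    rw [Complex.reCLM_apply] at this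
    rw [← this]
    congr 1
    ext θ
    rw [Complex.reCLM_apply, mul_comm, Complex.exp_ofReal_mul_I_re]
  have hsym : (∫ θ in (-π)..π, Real.cos (x * Real.sin θ - n * θ)) =
      2 * ∫ θ in (0:ℝ)..π, Real.cos (x * Real.sin θ - n * θ) := by
    rw [← intervalIntegral.integral_add_adjacent_intervals (b := 0)
      (Continuous.intervalIntegrable (by fun_prop) _ _)
      (Continuous.intervalIntegrable (by fun_prop) _ _), two_mul]
    congr 1
    have := intervalIntegral.integral_comp_neg (a := 0) (b := π)
      (fun θ => Real.cos (x * Real.sin θ - n * θ))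
    rw [neg_zero] at this
    rw [← this]
    congr 1
    ext θ
    rw [Real.sin_neg, ← Real.cos_neg]
    congr 1
    ring
  have hs' := Complex.hasSum_re hs
  rw [hre, hsym] at hs'
  have hs2 := hs'.mul_left (1 / (2 * π))
  have : 1 / π * (∫ θ in (0:ℝ)..π, Real.cos (x * Real.sin θ - n * θ)) =
      1 / (2 * π) * (2 * ∫ θ in (0:ℝ)..π, Real.cos (x * Real.sin θ - n * θ)) := by
    field_simp
  rw [this, ← hs2.tsum_eq, besselJ]
  congr 1
  ext m
  have hx2 : 0 < x / 2 := by positivity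
  rw [show (2 * (m:ℝ) + n) = ((2 * m + n : ℕ) : ℝ) by push_cast; ring, Real.rpow_natCast,
    show ((m:ℝ) + n + 1) = ((m + n : ℕ) : ℝ) + 1 by push_cast; ring, Real.Gamma_nat_eq_factorial]
  simp only [Function.comp]
  rw [if_pos trivial]
  have : (2 * π : ℂ) * ((x/2)^(m+n) / ((m+n).factorial : ℂ) * ((-x/2)^m / (m.factorial : ℂ))) =
    ((2 * π * ((x/2)^(m+n) / ((m+n).factorial : ℝ) * ((-x/2)^m / (m.factorial : ℝ))) : ℝ) : ℂ) := by
    push_cast; ring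
  rw [this, Complex.ofReal_re]
  rw [neg_div, neg_pow (x/2) m]
  have := Real.pi_pos
  field_simp
  ring

theorem besselJ_lip (n : ℕ) (x y : ℝ) (hx : 0 < x) (hy : 0 < y) :
    |besselJ n x - besselJ n y| ≤ |x - y| := by
  rw [besselJ_integral n x hx, besselJ_integral n y hy, ← mul_sub,
    ← intervalIntegral.integral_sub (Continuous.intervalIntegrable (by fun_prop) _ _)
      (Continuous.intervalIntegrable (by fun_prop) _ _), abs_mul]
  have h : ‖∫ θ in (0:ℝ)..π, (Real.cos (x * Real.sin θ - n * θ) - Real.cos (y * Real.sin θ - n * θ))‖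
      ≤ |x - y| * |π - 0| := by
    apply intervalIntegral.norm_integral_le_of_norm_le_const
    intro θ _
    rw [Real.norm_eq_abs]
    refine (Real.abs_cos_sub_cos_le _ _).trans ?_
    rw [show x * Real.sin θ - n * θ - (y * Real.sin θ - n * θ) = (x - y) * Real.sin θ by ring, abs_mul]
    exact mul_le_of_le_one_right (abs_nonneg _) (Real.abs_sin_le_one θ)
  rw [Real.norm_eq_abs, sub_zero, abs_of_pos Real.pi_pos] at h
  have hp := Real.pi_pos
  rw [abs_of_pos (by positivity : 0 < 1 / π)]
  calc 1 / π * _ ≤ 1 / π * (|x - y| * π) := by gcongr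
    _ = _ := by field_simp

noncomputable def psiC (α : ℝ) (z : ℂ) : ℂ := Complex.I * (α * Complex.sin z - z)

noncomputable def gamC (α e : ℝ) (θ : ℝ) : ℂ := θ + Complex.I * (e * (α * Real.cos θ - 1) : ℝ)

noncomputable def gamD (α e : ℝ) (θ : ℝ) : ℂ := 1 - Complex.I * (e * α * Real.sin θ : ℝ)

theorem gamC_hasDerivAt (α e θ : ℝ) : HasDerivAt (gamC α e) (gamD α e θ) θ := by
  have h1 : HasDerivAt (fun θ : ℝ => e * (α * Real.cos θ - 1)) (e * (α * (-Real.sin θ))) θ :=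
    (((Real.hasDerivAt_cos θ).const_mul α).sub_const 1).const_mul e
  have h2 := (HasDerivAt.ofReal_comp (hasDerivAt_id θ)).add (h1.ofReal_comp.const_mul Complex.I)
  refine h2.congr_deriv ?_
  unfold gamD
  push_cast
  ring

theorem psiC_hasDerivAt (α : ℝ) (z : ℂ) :
    HasDerivAt (psiC α) (Complex.I * (α * Complex.cos z - 1)) z :=
  (((Complex.hasDerivAt_sin z).const_mul (α:ℂ)).sub (hasDerivAt_id z)).const_mul Complex.I

theorem psiC_re (α x y : ℝ) :
    (psiC α (x + Complex.I * y)).re = y - α * Real.cos x * Real.sinh y := by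
  unfold psiC
  rw [mul_comm Complex.I (y:ℂ), Complex.sin_add_mul_I]
  simp [Complex.cosh_ofReal_re, Complex.sinh_ofReal_re, Complex.sin_ofReal_re, Complex.cos_ofReal_re]
  ring

theorem psiC_im (α x y : ℝ) :
    (psiC α (x + Complex.I * y)).im = α * Real.sin x * Real.cosh y - x := by
  unfold psiC
  rw [mul_comm Complex.I (y:ℂ), Complex.sin_add_mul_I]
  simp [Complex.cosh_ofReal_re, Complex.sinh_ofReal_re, Complex.sin_ofReal_re, Complex.cos_ofReal_re]
  ring

theorem vert_const (α : ℝ) (n : ℕ) (G : ℂ → ℂ)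
    (hG : ∀ z, HasDerivAt G (Complex.exp (n * psiC α z)) z) (x : ℝ)
    (hx : ∀ y : ℝ, (Complex.exp (n * psiC α (x + Complex.I * y))).im = 0) (y : ℝ) :
    (G (x + Complex.I * y)).re = (G x).re := by
  have hd : ∀ y : ℝ, HasDerivAt (fun y : ℝ => (G (x + Complex.I * y)).re) 0 y := by
    intro y
    have h1 : HasDerivAt (fun y : ℝ => (x:ℂ) + Complex.I * y) (Complex.I * 1) y :=
      ((HasDerivAt.ofReal_comp (hasDerivAt_id y)).const_mul Complex.I).const_add _
    have h2 : HasDerivAt (fun y : ℝ => G ((x:ℂ) + Complex.I * y)) _ y := (hG _).comp y h1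
    have h3 := Complex.reCLM.hasFDerivAt.comp_hasDerivAt y h2
    refine h3.congr_deriv ?_
    rw [Complex.reCLM_apply, mul_one, Complex.mul_I_re, hx, neg_zero]
  have := is_const_of_deriv_eq_zero (fun y => (hd y).differentiableAt) (fun y => (hd y).deriv) y 0
  simpa using this

theorem gamD_cont (α e : ℝ) : Continuous (gamD α e) := by
  unfold gamD; fun_prop

theorem gamC_cont (α e : ℝ) : Continuous (gamC α e) := by
  unfold gamC; fun_prop

theorem psiC_cont (α : ℝ) : Continuous (psiC α) := by
  unfold psiC; fun_prop

theorem contour (α e : ℝ) (n : ℕ) :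
    (∫ θ in (0:ℝ)..π, Real.cos (n * α * Real.sin θ - n * θ)) =
    (∫ θ in (0:ℝ)..π, Complex.exp (n * psiC α (gamC α e θ)) * gamD α e θ).re := by
  have hdiff : Differentiable ℂ (fun z => Complex.exp (n * psiC α z)) := by
    unfold psiC; fun_prop
  obtain ⟨G, hG⟩ := hdiff.isExactOn_univ
  replace hG : ∀ z, HasDerivAt G (Complex.exp (n * psiC α z)) z := fun z => hG z (mem_univ z)
  have c1 := gamC_cont α e
  have c2 := gamD_cont α e
  have c3 := psiC_cont α
  have h1 : (∫ θ in (0:ℝ)..π, Complex.exp (n * psiC α (gamC α e θ)) * gamD α e θ) =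
      G (gamC α e π) - G (gamC α e 0) := by
    apply intervalIntegral.integral_eq_sub_of_hasDerivAt (f := fun θ => G (gamC α e θ))
    · intro θ _
      exact (hG _).comp θ (gamC_hasDerivAt α e θ)
    · apply Continuous.intervalIntegrable
      fun_prop
  have h2 : (∫ θ in (0:ℝ)..π, Complex.exp (n * psiC α (θ:ℝ))) =
      G (π:ℝ) - G (0:ℝ) := by
    apply intervalIntegral.integral_eq_sub_of_hasDerivAt (f := fun θ : ℝ => G θ)
    · intro θ _
      exact (hG θ).comp_ofReal
    · apply Continuous.intervalIntegrable
      fun_prop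
  have h3 : (∫ θ in (0:ℝ)..π, Real.cos (n * α * Real.sin θ - n * θ)) =
      (∫ θ in (0:ℝ)..π, Complex.exp (n * psiC α (θ:ℝ))).re := by
    have := Complex.reCLM.intervalIntegral_comp_comm (μ := MeasureTheory.volume) (a := 0) (b := π)
      (f := fun θ : ℝ => Complex.exp (n * psiC α (θ:ℝ)))
      (Continuous.intervalIntegrable (by fun_prop) _ _)
    rw [Complex.reCLM_apply] at this
    rw [← this]
    congr 1
    ext θ
    rw [Complex.reCLM_apply, ← Complex.exp_ofReal_mul_I_re]
    congr 2
    unfold psiC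
    push_cast
    ring
  have v0 : ∀ y : ℝ, (Complex.exp (n * psiC α ((0:ℝ) + Complex.I * y))).im = 0 := by
    intro y
    rw [Complex.exp_im]
    have : (n * psiC α ((0:ℝ) + Complex.I * y)).im = 0 := by
      rw [← Complex.ofReal_natCast, Complex.im_ofReal_mul, psiC_im]; simp
    rw [this]; simp
  have vp : ∀ y : ℝ, (Complex.exp (n * psiC α ((π:ℝ) + Complex.I * y))).im = 0 := by
    intro y
    rw [Complex.exp_im]
    have : (n * psiC α ((π:ℝ) + Complex.I * y)).im = -(n * π) := by
      rw [← Complex.ofReal_natCast, Complex.im_ofReal_mul, psiC_im]; simp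
    rw [this]; simp
  rw [h3, h2, h1, Complex.sub_re, Complex.sub_re]
  unfold gamC
  rw [vert_const α n G hG 0 v0, vert_const α n G hG π vp]

theorem sinh_bd (s : ℝ) (hs : |s| ≤ 1) : |Real.sinh s - s| ≤ |s|^3 := by
  have h1 := Real.exp_bound hs (n := 3) (by norm_num)
  have h2 := Real.exp_bound (x := -s) (by rwa [abs_neg]) (n := 3) (by norm_num)
  rw [abs_neg] at h2
  simp [Finset.sum_range_succ, Nat.factorial] at h1 h2
  rw [Real.sinh_eq]
  have h0 : 0 ≤ |s|^3 := by positivity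
  rw [abs_le] at h1 h2 ⊢
  constructor <;> nlinarith [h1.1, h1.2, h2.1, h2.2]

theorem key_bd (α u : ℝ) (hα : 1 < α) (hu : |u| ≤ α) :
    1/(2*(α+1))*(u-1) - u * Real.sinh (1/(2*(α+1))*(u-1)) ≤ - (1/(4*(α+1))) * (u-1)^2 := by
  have hα1 : 0 < α + 1 := by linarith
  set e := 1/(2*(α+1)) with he
  have he0 : 0 < e := by positivity
  have heα : e * (α + 1) = 1/2 := by rw [he]; field_simp
  have hq : 1/(4*(α+1)) = e / 2 := by rw [he]; field_simp; norm_num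
  rw [hq]
  set s := e*(u-1) with hs
  have hu1 : |u - 1| ≤ α + 1 := by
    rw [abs_le] at *; constructor <;> linarith
  have hs1 : |s| ≤ 1/2 := by
    rw [hs, abs_mul, abs_of_pos he0, ← heα]; gcongr
  have hb := sinh_bd s (by linarith)
  have h3 : |u * (Real.sinh s - s)| ≤ α * |s|^3 := by
    rw [abs_mul]; gcongr
  have h4 : α * |s|^3 ≤ e/2 * (u-1)^2 := by
    have : |s|^3 = e^2 * (u-1)^2 * |s| := by
      rw [pow_succ, sq_abs, hs]; ring
    rw [this]
    have h5 : α * (e^2 * (u-1)^2 * |s|) ≤ α * (e^2 * (u-1)^2 * (1/2)) := by gcongr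
    have h6 : e * α ≤ 1/2 := by nlinarith
    have h7 : 0 ≤ e * (u-1)^2 := by positivity
    nlinarith
  have h5 := (abs_le.mp (h3.trans h4)).1
  nlinarith

theorem cos_bd (t : ℝ) (ht0 : 0 < t) (htp : t < π) :
    ∃ c > 0, ∀ θ ∈ Icc 0 π, c * (θ - t)^2 ≤ (Real.cos θ - Real.cos t)^2 := by
  have hpi := Real.pi_pos
  set m := min (Real.sin (t/2)) (Real.cos (t/2)) with hm
  have hm0 : 0 < m := lt_min (Real.sin_pos_of_pos_of_lt_pi (by linarith) (by linarith))
    (Real.cos_pos_of_mem_Ioo ⟨by linarith, by linarith⟩)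
  refine ⟨(2 * m * (1 / π))^2, by positivity, ?_⟩
  rintro θ ⟨h0, h1⟩
  have hA : m ≤ Real.sin ((θ + t)/2) := by
    by_cases h : (θ + t)/2 ≤ π/2
    · refine (min_le_left _ _).trans ?_
      exact Real.sin_le_sin_of_le_of_le_pi_div_two (by linarith) h (by linarith)
    · refine (min_le_right _ _).trans ?_
      rw [show (θ + t)/2 = (θ+t)/2 - π/2 + π/2 by ring, Real.sin_add_pi_div_two]
      exact Real.cos_le_cos_of_nonneg_of_le_pi (by linarith) (by linarith) (by linarith)
  have hB : 2 / π * |(θ - t)/2| ≤ |Real.sin ((θ - t)/2)| :=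
    Real.mul_abs_le_abs_sin (by rw [abs_le]; constructor <;> linarith)
  rw [Real.cos_sub_cos, ← sq_abs (θ - t), ← mul_pow, ← sq_abs (-2 * _ * _)]
  apply pow_le_pow_left₀ (by positivity)
  rw [abs_mul, abs_mul, abs_neg, abs_two, abs_of_pos (lt_of_lt_of_le hm0 hA)]
  rw [abs_div, abs_two] at hB
  calc 2 * m * (1 / π) * |θ - t| = 2 * m * (2 / π * (|θ - t| / 2)) := by ring
    _ ≤ _ := mul_le_mul (mul_le_mul_of_nonneg_left hA (by norm_num)) hB (by positivity)
      (mul_nonneg (by norm_num) (hm0.le.trans hA))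

theorem taylor2 (f f' : ℝ → ℂ) (c : ℂ) (x₀ : ℝ) (hf : ContDiff ℝ 2 f)
    (h1 : ∀ x, HasDerivAt f (f' x) x) (h2 : HasDerivAt f' c x₀) (h0 : f' x₀ = 0) (t : ℝ) :
    Tendsto (fun n : ℕ => (n:ℂ) * (f (x₀ + t / √n) - f x₀)) atTop (nhds (c / 2 * t^2)) := by
  have hT := taylor_isLittleO_univ (x₀ := x₀) (n := 2) (f := f) hf
  have hd : deriv f = f' := funext fun x => (h1 x).deriv
  have hev : ∀ x, taylorWithinEval f 2 univ x₀ x = f x₀ + ((x - x₀)^2 / 2 : ℝ) * c := by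
    intro x
    rw [taylorWithinEval_succ, taylorWithinEval_succ, taylor_within_zero_eval]
    simp only [iteratedDerivWithin_univ, zero_add, iteratedDeriv_one]
    rw [show iteratedDeriv (1+1) f x₀ = c by
      rw [iteratedDeriv_succ, iteratedDeriv_one, hd]; exact h2.deriv, hd, h0]
    simp only [Complex.real_smul, smul_zero, add_zero]
    congr 2
    push_cast
    simp
    ring
  simp_rw [hev] at hT
  have hx : Tendsto (fun n : ℕ => x₀ + t / √n) atTop (nhds x₀) := by
    have : Tendsto (fun n : ℕ => t / √(n:ℝ)) atTop (nhds 0) :=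
      tendsto_const_nhds.div_atTop (Real.tendsto_sqrt_atTop.comp tendsto_natCast_atTop_atTop)
    simpa using this.const_add x₀
  have hT2 := hT.comp_tendsto hx
  have hO : (fun n : ℕ => (n:ℂ) * (f (x₀ + t / √n) - (f x₀ + (((x₀ + t / √n) - x₀)^2 / 2 : ℝ) * c)))
      =o[atTop] (fun n : ℕ => (n:ℝ) * ((x₀ + t / √n) - x₀)^2) := by
    refine Asymptotics.IsBigO.mul_isLittleO ?_ hT2
    exact Asymptotics.isBigO_of_le _ (fun n => by simp)
  have hO1 : (fun n : ℕ => (n:ℝ) * ((x₀ + t / √n) - x₀)^2) =O[atTop] (fun _ : ℕ => (1:ℝ)) := by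
    refine Asymptotics.IsBigO.of_bound (t^2) (Eventually.of_forall fun n => ?_)
    rw [add_sub_cancel_left, div_pow, Real.sq_sqrt (Nat.cast_nonneg n)]
    rcases Nat.eq_zero_or_pos n with rfl | hn
    · simp; positivity
    · have : (0:ℝ) < n := by exact_mod_cast hn
      rw [mul_div_cancel₀ _ this.ne']
      simp
  have hz := (Asymptotics.isLittleO_one_iff ℝ).mp (hO.trans_isBigO hO1)
  have := hz.add_const (c / 2 * t^2)
  rw [zero_add] at this
  refine this.congr' ?_
  filter_upwards [eventually_gt_atTop 0] with n hn
  have hn' : (0:ℝ) < n := by exact_mod_cast hn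
  have : (x₀ + t / √n - x₀)^2 / 2 = t^2 / n / 2 := by
    rw [add_sub_cancel_left, div_pow, Real.sq_sqrt hn'.le]
  rw [this]
  have hnc : (n:ℂ) ≠ 0 := by exact_mod_cast hn.ne'
  push_cast
  field_simp
  ring

theorem gauss_limit (f g : ℝ → ℂ) (x₀ C c : ℝ) (b : ℂ) (hx₀ : x₀ ∈ Ioo 0 π) (hc : 0 < c)
    (hb : 0 < b.re) (hfc : Continuous f) (hgc : Continuous g)
    (hfb : ∀ θ ∈ Icc 0 π, (f θ - f x₀).re ≤ - c * (θ - x₀)^2)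
    (hg : ∀ θ, ‖g θ‖ ≤ C)
    (hlim : ∀ t : ℝ, Tendsto (fun n : ℕ => (n:ℂ) * (f (x₀ + t / √n) - f x₀)) atTop
      (nhds (-b * t^2))) :
    Tendsto (fun n : ℕ => (√n : ℂ) * ∫ θ in (0:ℝ)..π, Complex.exp (n * (f θ - f x₀)) * g θ) atTop
      (nhds ((π / b) ^ (1 / 2 : ℂ) * g x₀)) := by
  let F : ℕ → ℝ → ℂ := fun n => indicator (Ioc 0 π) (fun θ => Complex.exp (n * (f θ - f x₀)) * g θ)
  have hF : ∀ n : ℕ, (∫ θ in (0:ℝ)..π, Complex.exp (n * (f θ - f x₀)) * g θ) = ∫ θ, F n θ := by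
    intro n
    rw [intervalIntegral.integral_of_le Real.pi_pos.le, ← MeasureTheory.integral_indicator measurableSet_Ioc]
  have hsc : ∀ n : ℕ, 0 < n → (√n : ℂ) * (∫ θ, F n θ) = ∫ t, F n (x₀ + t / √n) := by
    intro n hn
    have hn' : (0:ℝ) < √n := Real.sqrt_pos.mpr (by exact_mod_cast hn)
    have h1 := MeasureTheory.Measure.integral_comp_div (fun t => F n (x₀ + t)) (√n)
    rw [h1, MeasureTheory.integral_add_left_eq_self (F n) x₀, abs_of_pos hn', Complex.real_smul]
  have hlimF : Tendsto (fun n : ℕ => ∫ t, F n (x₀ + t / √n)) atTop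
      (nhds (∫ t : ℝ, Complex.exp (-b * t^2) * g x₀)) := by
    have hxt : ∀ t : ℝ, Tendsto (fun n : ℕ => x₀ + t / √n) atTop (nhds x₀) := by
      intro t
      have : Tendsto (fun n : ℕ => t / √(n:ℝ)) atTop (nhds 0) :=
        tendsto_const_nhds.div_atTop (Real.tendsto_sqrt_atTop.comp tendsto_natCast_atTop_atTop)
      simpa using this.const_add x₀
    refine MeasureTheory.tendsto_integral_filter_of_dominated_convergence
      (fun t => Real.exp (-c * t^2) * C) ?_ ?_ ?_ ?_
    · refine Eventually.of_forall fun n => Measurable.aestronglyMeasurable ?_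
      have : Measurable (F n) := by
        apply Measurable.indicator _ measurableSet_Ioc
        exact Continuous.measurable (by fun_prop)
      exact this.comp (by fun_prop)
    · filter_upwards [eventually_gt_atTop 0] with n hn
      refine Eventually.of_forall fun t => ?_
      have hn' : (0:ℝ) < n := by exact_mod_cast hn
      have hC : 0 ≤ C := (norm_nonneg _).trans (hg 0)
      by_cases hm : x₀ + t / √n ∈ Ioc 0 π
      · simp only [F]
        rw [indicator_of_mem hm, norm_mul, Complex.norm_exp]
        refine mul_le_mul (Real.exp_le_exp.mpr ?_) (hg _) (norm_nonneg _) (Real.exp_pos _).le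
        rw [← Complex.ofReal_natCast, Complex.re_ofReal_mul]
        have := mul_le_mul_of_nonneg_left (hfb _ (Ioc_subset_Icc_self hm)) hn'.le
        refine this.trans (le_of_eq ?_)
        rw [add_sub_cancel_left, div_pow, Real.sq_sqrt hn'.le]
        field_simp
      · simp only [F]
        rw [indicator_of_notMem hm, norm_zero]
        positivity
    · exact (integrable_exp_neg_mul_sq hc).mul_const C
    · refine Eventually.of_forall fun t => ?_
      have h1 : Tendsto (fun n : ℕ => Complex.exp ((n:ℂ) * (f (x₀ + t / √n) - f x₀)) * g (x₀ + t / √n))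
          atTop (nhds (Complex.exp (-b * t^2) * g x₀)) :=
        ((Complex.continuous_exp.tendsto _).comp (hlim t)).mul ((hgc.tendsto x₀).comp (hxt t))
      refine h1.congr' ?_
      have hnh : Ioc 0 π ∈ nhds x₀ := Ioc_mem_nhds hx₀.1 hx₀.2
      filter_upwards [(hxt t).eventually hnh] with n hn
      simp only [F]
      rw [indicator_of_mem (show x₀ + t / √n ∈ Ioc 0 π from hn)]
  rw [MeasureTheory.integral_mul_const, integral_gaussian_complex hb] at hlimF
  refine hlimF.congr' ?_
  filter_upwards [eventually_gt_atTop 0] with n hn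
  rw [hF, hsc n hn]

theorem cos_ne (p q : ℕ) (hp : 0 < p) (hcop : Nat.Coprime p q)
    (hcond : ¬(4 ∣ p) ∨ 2 ∣ q) (n : ℕ) : Real.cos (n * (π * q / p) - π / 4) ≠ 0 := by
  intro h
  obtain ⟨k, hk⟩ := Real.cos_eq_zero_iff.mp h
  have hp' : (0:ℝ) < p := by exact_mod_cast hp
  have h1 : (4 * n * q : ℝ) = p * (4 * k + 3) := by
    have := Real.pi_pos
    field_simp at hk
    linear_combination hk / 2
  have h2 : (4 * n * q : ℤ) = p * (4 * k + 3) := by exact_mod_cast h1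
  have h4 : (4:ℤ) ∣ p := by
    have hd : (4:ℤ) ∣ p * (4 * k + 3) := ⟨n * q, by rw [← h2]; ring⟩
    refine IsCoprime.dvd_of_dvd_mul_right ?_ hd
    exact ⟨k + 1, -1, by ring⟩
  have h4' : 4 ∣ p := by exact_mod_cast h4
  rcases hcond with h | h
  · exact h h4'
  · have := Nat.dvd_gcd (dvd_trans (by norm_num : 2 ∣ 4) h4') h
    rw [hcop.gcd_eq_one] at this
    omega

theorem cos_lb (p q : ℕ) (hp : 0 < p) (hcop : Nat.Coprime p q)
    (hcond : ¬(4 ∣ p) ∨ 2 ∣ q) :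
    ∃ δ > 0, ∀ n : ℕ, δ ≤ |Real.cos (n * (π * q / p) - π / 4)| := by
  obtain ⟨m, _, hm⟩ := Finset.exists_min_image (Finset.range (2 * p))
    (fun n : ℕ => |Real.cos (n * (π * q / p) - π / 4)|) ⟨0, by simp; omega⟩
  refine ⟨_, abs_pos.mpr (cos_ne p q hp hcop hcond m), fun n => ?_⟩
  have h1 := hm (n % (2 * p)) (by simp; exact Nat.mod_lt _ (by omega))
  refine h1.trans (le_of_eq ?_)
  congr 1
  have hp' : (0:ℝ) < p := by exact_mod_cast hp
  have hn : (n:ℝ) = ((n % (2*p) : ℕ) : ℝ) + 2 * p * ((n / (2*p) : ℕ) : ℝ) := by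
    exact_mod_cast (Nat.mod_add_div n (2*p)).symm
  have := Real.cos_add_nat_mul_two_pi (((n % (2*p) : ℕ) : ℝ) * (π * q / p) - π / 4) (n / (2*p) * q)
  rw [← this]
  congr 1
  push_cast
  rw [hn]
  push_cast
  field_simp
  simp only [mul_comm]
  ring

theorem bessel_lb (α : ℝ) (hα : 1 < α)
    (p q : ℕ) (hp : 0 < p) (hq : 0 < q) (hcop : Nat.Coprime p q)
    (hpq : sigmaF α = (p:ℝ)/q)
    (hcond : ¬(4 ∣ p) ∨ 2 ∣ q) :
    ∃ δ > 0, ∀ᶠ n : ℕ in atTop, δ ≤ √n * |besselJ n (n * α)| := by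
  have hpi := Real.pi_pos
  have hα0 : 0 < α := by linarith
  have hinv1 : 1 / α < 1 := by rw [div_lt_one hα0]; exact hα
  have hinv0 : 0 < 1 / α := by positivity
  set t := Real.arccos (1/α) with ht
  have ht0 : 0 < t := Real.arccos_pos.mpr hinv1
  have htp : t < π := by
    have := Real.arccos_lt_pi_div_two.mpr hinv0
    linarith
  have hcos : Real.cos t = 1 / α := Real.cos_arccos (by linarith) hinv1.le
  have hαcos : α * Real.cos t = 1 := by rw [hcos]; field_simp
  have hsin0 : 0 < Real.sin t := Real.sin_pos_of_pos_of_lt_pi ht0 htp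
  set a := α * Real.sin t with ha
  have ha0 : 0 < a := by positivity
  have hasq : √(α^2 - 1) = a := by
    have h1 := Real.sin_sq_add_cos_sq t
    have h2 : α^2 - 1 = a^2 := by
      rw [ha]
      linear_combination (-α^2) * h1 + (α * Real.cos t + 1) * hαcos
    rw [h2, Real.sqrt_sq ha0.le]
  have hp' : (0:ℝ) < p := by exact_mod_cast hp
  have hq' : (0:ℝ) < q := by exact_mod_cast hq
  have hg : a - t = π * q / p := by
    unfold sigmaF at hpq
    rw [hasq, ← ht] at hpq
    have hne : a - t ≠ 0 := by
      intro h0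
      rw [h0, div_zero] at hpq
      have : 0 < (p:ℝ)/q := by positivity
      linarith
    field_simp at hpq ⊢
    linarith
  set e := 1/(2*(α+1)) with he
  have he0 : 0 < e := by positivity
  set f : ℝ → ℂ := fun θ => psiC α (gamC α e θ) with hf
  set f' : ℝ → ℂ := fun θ => Complex.I * (α * Complex.cos (gamC α e θ) - 1) * gamD α e θ with hf'
  have hgt : gamC α e t = t := by
    unfold gamC
    rw [hαcos]; simp
  have hdt : gamD α e t = 1 - Complex.I * (e * a : ℝ) := by
    unfold gamD; rw [mul_assoc e, ← ha]
  have hαcosC : (α:ℂ) * Complex.cos t = 1 := by exact_mod_cast congrArg Complex.ofReal hαcos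
  have haC : (α:ℂ) * Complex.sin t = a := by rw [ha]; push_cast; rfl
  have hfd : ∀ x, HasDerivAt f (f' x) x := fun x =>
    (psiC_hasDerivAt α _).comp x (gamC_hasDerivAt α e x)
  have hf't : f' t = 0 := by simp [hf', hgt, hαcosC]
  have hgdd : DifferentiableAt ℝ (gamD α e) t := by
    unfold gamD; fun_prop
  have hf2 : HasDerivAt f' (-Complex.I * a * gamD α e t ^ 2) t := by
    have h1 : HasDerivAt (fun z : ℂ => Complex.I * (α * Complex.cos z - 1))
        (Complex.I * (α * (-Complex.sin (gamC α e t)))) (gamC α e t) :=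
      (((Complex.hasDerivAt_cos _).const_mul (α:ℂ)).sub_const 1).const_mul Complex.I
    have h2 := (h1.comp t (gamC_hasDerivAt α e t)).mul hgdd.hasDerivAt
    refine h2.congr_deriv ?_
    simp only [Function.comp, hgt]
    rw [hαcosC, mul_neg, haC]
    ring
  have hcd : ContDiff ℝ 2 f := by
    have g1 : ContDiff ℝ 2 (fun x : ℝ => (x:ℂ)) := Complex.ofRealCLM.contDiff
    have g2 : ContDiff ℝ 2 (fun x : ℝ => ((e * (α * Real.cos x - 1) : ℝ) : ℂ)) := by
      refine g1.comp ?_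
      fun_prop
    have g3 : ContDiff ℝ 2 (gamC α e) := g1.add (contDiff_const.mul g2)
    have g4 : ContDiff ℝ 2 (psiC α) := by
      have g5 : ContDiff ℂ 2 (psiC α) := by
        unfold psiC; fun_prop
      exact g5.restrict_scalars ℝ
    exact g4.comp g3
  set b : ℂ := Complex.I * a * gamD α e t ^ 2 / 2 with hb
  have hlim : ∀ s : ℝ, Tendsto (fun n : ℕ => (n:ℂ) * (f (t + s / √n) - f t)) atTop
      (nhds (-b * s^2)) := by
    intro s
    have := taylor2 f f' _ t hcd hfd hf2 hf't s
    convert this using 2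
    rw [hb]; ring
  have hbre : 0 < b.re := by
    have : b.re = e * a^2 := by
      rw [hb, hdt]
      simp [pow_two]
      ring
    rw [this]; positivity
  have hft : f t = Complex.I * (π * q / p : ℝ) := by
    simp only [hf]
    rw [hgt]; unfold psiC
    rw [haC, ← hg]; push_cast; ring
  have hft_re : (f t).re = 0 := by rw [hft]; simp
  obtain ⟨c, hc0, hc⟩ := cos_bd t ht0 htp
  have hfb : ∀ θ ∈ Icc 0 π, (f θ - f t).re ≤ - ((1/(4*(α+1))) * (α^2 * c)) * (θ - t)^2 := by
    intro θ hθ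
    rw [Complex.sub_re, hft_re, sub_zero]
    simp only [hf]
    unfold gamC
    rw [psiC_re]
    refine (key_bd α (α * Real.cos θ) hα ?_).trans ?_
    · rw [abs_mul, abs_of_pos hα0]
      exact mul_le_of_le_one_right hα0.le (Real.abs_cos_le_one θ)
    · have h1 := hc θ hθ
      have h2 : (α * Real.cos θ - 1)^2 = α^2 * (Real.cos θ - Real.cos t)^2 := by
        rw [← hαcos]; ring
      rw [h2]
      have h3 : 0 ≤ 1/(4*(α+1)) * α^2 := by positivity
      nlinarith [mul_le_mul_of_nonneg_left h1 h3]
  have hgb : ∀ θ, ‖gamD α e θ‖ ≤ 1 + e * α := by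
    intro θ
    unfold gamD
    refine (norm_sub_le _ _).trans ?_
    rw [norm_one, norm_mul, Complex.norm_I, one_mul, Complex.norm_real, Real.norm_eq_abs, abs_mul,
      abs_of_pos (by positivity : 0 < e * α)]
    have := mul_le_of_le_one_right (by positivity : 0 ≤ e * α) (Real.abs_sin_le_one θ)
    linarith
  have hmain := gauss_limit f (gamD α e) t (1 + e * α) _ b ⟨ht0, htp⟩ (by positivity) hbre
    hcd.continuous (gamD_cont α e) hfb hgb hlim
  set L : ℂ := (π / b) ^ (1 / 2 : ℂ) * gamD α e t with hL
  have hdne : gamD α e t ≠ 0 := by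
    intro h0
    have := congrArg Complex.re h0
    rw [hdt] at this
    simp at this
  have hbne : b ≠ 0 := by
    intro h0; rw [h0] at hbre; simp at hbre
  set A : ℝ := √(2 * π / a) with hA
  have hA0 : 0 < A := by positivity
  have hL2 : L^2 = (A * Complex.exp (-(π/4 : ℝ) * Complex.I))^2 := by
    have e1 : ((π / b : ℂ) ^ (1 / 2 : ℂ))^2 = π / b := by
      rw [← Complex.cpow_nat_mul]; simp
    have e2 : (A:ℂ)^2 = 2 * π / a := by
      rw [← Complex.ofReal_pow, hA, Real.sq_sqrt (by positivity)]; push_cast; rfl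
    have e3 : Complex.exp (-(π/4 : ℝ) * Complex.I) ^ 2 = -Complex.I := by
      rw [← Complex.exp_nat_mul, ← Complex.exp_neg_pi_div_two_mul_I]
      congr 1; push_cast; ring
    rw [hL, mul_pow, mul_pow, e1, e2, e3, hb]
    have haC0 : (a:ℂ) ≠ 0 := by exact_mod_cast ha0.ne'
    have := Complex.I_ne_zero
    field_simp
    rw [Complex.I_sq]; ring
  have hLre : ∀ n : ℕ, |(Complex.exp (n * f t) * L).re| = A * |Real.cos (n * (π * q / p) - π/4)| := by
    intro n
    have key : (Complex.exp (n * f t) * (A * Complex.exp (-(π/4 : ℝ) * Complex.I))).re =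
        A * Real.cos (n * (π * q / p) - π/4) := by
      rw [mul_left_comm, Complex.re_ofReal_mul, ← Complex.exp_add, ← Complex.exp_ofReal_mul_I_re]
      congr 3
      rw [hft]; push_cast; ring
    rcases sq_eq_sq_iff_eq_or_eq_neg.mp hL2 with h | h
    · rw [h, key, abs_mul, abs_of_pos hA0]
    · rw [h, mul_neg, Complex.neg_re, key, abs_neg, abs_mul, abs_of_pos hA0]
  obtain ⟨δ, hδ0, hδ⟩ := cos_lb p q hp hcop hcond
  refine ⟨A * δ / 2 / π, by positivity, ?_⟩
  have hdist := (Metric.tendsto_nhds.mp hmain) (A * δ / 2) (by positivity)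
  filter_upwards [hdist, eventually_gt_atTop 0] with n hn hn0
  have hn' : (0:ℝ) < n := by exact_mod_cast hn0
  set S : ℂ := (√n : ℂ) * ∫ θ in (0:ℝ)..π, Complex.exp (n * (f θ - f t)) * gamD α e θ with hS
  have hJ : √n * besselJ n (n * α) = 1 / π * (Complex.exp (n * f t) * S).re := by
    rw [besselJ_integral n _ (by positivity), contour α e n, hS, mul_left_comm (Complex.exp _),
      Complex.re_ofReal_mul, ← intervalIntegral.integral_const_mul]
    have : ∀ θ : ℝ, Complex.exp (n * f t) * (Complex.exp (n * (f θ - f t)) * gamD α e θ) =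
        Complex.exp (n * psiC α (gamC α e θ)) * gamD α e θ := by
      intro θ
      rw [← mul_assoc, ← Complex.exp_add]
      congr 2
      simp only [hf]; ring
    simp_rw [this]
    ring
  have hE : ‖Complex.exp (n * f t)‖ = 1 := by
    rw [Complex.norm_exp, ← Complex.ofReal_natCast, Complex.re_ofReal_mul, hft_re]; simp
  have h1 : |(Complex.exp (n * f t) * L).re| ≤ |(Complex.exp (n * f t) * S).re| + A * δ / 2 := by
    have : (Complex.exp (n * f t) * L).re = (Complex.exp (n * f t) * S).re -
        (Complex.exp (n * f t) * (S - L)).re := by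
      rw [← Complex.sub_re]; congr 1; ring
    rw [this]
    refine (abs_sub _ _).trans ?_
    gcongr
    refine (Complex.abs_re_le_norm _).trans ?_
    rw [norm_mul, hE, one_mul, ← dist_eq_norm]
    exact hn.le
  rw [hLre] at h1
  have h2 := mul_le_mul_of_nonneg_left (hδ n) hA0.le
  have h3 : √n * |besselJ n (n * α)| = |(Complex.exp (n * f t) * S).re| / π := by
    have h4 : √n * |besselJ n (n * α)| = |√n * besselJ n (n * α)| := by
      rw [abs_mul, abs_of_nonneg (Real.sqrt_nonneg (n:ℝ))]
    rw [h4, hJ, abs_mul, abs_of_pos (by positivity : 0 < 1 / π)]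
    ring
  rw [h3]
  gcongr
  linarith

theorem fin_bdd (α : ℝ) (hα : 1 < α)
    (p q : ℕ) (hp : 0 < p) (hq : 0 < q) (hcop : Nat.Coprime p q)
    (hpq : sigmaF α = (p:ℝ)/q)
    (hcond : ¬(4 ∣ p) ∨ 2 ∣ q)
    (J : ℝ → ℕ → ℝ)
    (hJpos : ∀ ν : ℝ, 0 ≤ ν → ∀ k : ℕ, 1 ≤ k → 0 < J ν k)
    (hJmono : ∀ ν : ℝ, 0 ≤ ν → ∀ k l : ℕ, 1 ≤ k → k < l → J ν k < J ν l)
    (hJzero : ∀ ν : ℝ, 0 ≤ ν → ∀ k : ℕ, 1 ≤ k → besselJ ν (J ν k) = 0)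
    (hJall : ∀ ν : ℝ, 0 ≤ ν → ∀ z : ℝ, 0 < z → besselJ ν z = 0 →
      ∃ k : ℕ, 1 ≤ k ∧ J ν k = z) (M : ℝ) (hM : 0 < M) :
    {z : ℕ × ℕ | 1 ≤ z.2 ∧ |(J z.1 z.2)^2 - α^2*(z.1:ℝ)^2| ≤ M}.Finite := by
  have hα0 : 0 < α := by linarith
  -- for every order the zeros tend to infinity
  have hunb : ∀ (n : ℕ) (B : ℝ), ∃ K : ℕ, ∀ k, K ≤ k → B < J n k := by
    intro n B
    by_contra! hcon
    have hn0 : (0:ℝ) ≤ n := Nat.cast_nonneg n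
    have hbd : ∀ k, 1 ≤ k → J n k ≤ B := by
      intro k hk
      obtain ⟨l, hl, hlB⟩ := hcon (k+1)
      exact (hJmono n hn0 k l hk (by omega)).le.trans hlB
    set u : ℕ → ℝ := fun k => J n (k+1) with hu
    have humono : Monotone u := by
      refine monotone_nat_of_le_succ fun k => ?_
      exact (hJmono n hn0 _ _ (by omega) (by omega)).le
    have hubd : BddAbove (range u) := ⟨B, by rintro _ ⟨k, rfl⟩; exact hbd _ (by omega)⟩
    have hlim := tendsto_atTop_ciSup humono hubd
    set z := ⨆ i, u i with hz
    have hle : ∀ k, u k ≤ z := fun k => le_ciSup hubd k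
    have hz0 : 0 < z := (hJpos n hn0 1 le_rfl).trans_le (hle 0)
    have hzero : besselJ n z = 0 := by
      have h1 : ∀ k, |besselJ n z| ≤ |z - u k| := by
        intro k
        have := besselJ_lip n z (u k) hz0 (hJpos n hn0 _ (by omega))
        rwa [hJzero n hn0 _ (by omega), sub_zero] at this
      have h2 : Tendsto (fun k => |z - u k|) atTop (nhds 0) := by
        have := (hlim.const_sub z).abs
        simpa using this
      have h3 := ge_of_tendsto' h2 h1
      exact abs_eq_zero.mp (le_antisymm h3 (abs_nonneg _))
    obtain ⟨k, hk, hkz⟩ := hJall n hn0 z hz0 hzero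
    have h1 := hJmono n hn0 k (k+1) hk (by omega)
    have h2 := hle k
    simp only [hu] at h2
    linarith
  obtain ⟨δ, hδ0, hδ⟩ := bessel_lb α hα p q hp hq hcop hpq hcond
  have hsq : Tendsto (fun n : ℕ => √(n:ℝ)) atTop atTop :=
    Real.tendsto_sqrt_atTop.comp tendsto_natCast_atTop_atTop
  obtain ⟨N, hN⟩ := eventually_atTop.mp
    ((hδ.and (hsq.eventually_gt_atTop (M / (α * δ)))).and (eventually_gt_atTop 0))
  choose K hK using fun n : ℕ => hunb n (√(M + α^2 * (n:ℝ)^2))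
  refine Set.Finite.subset (s := ⋃ n ∈ Finset.range N, (fun k => (n, k)) '' (Finset.range (K n) : Set ℕ))
    ?_ ?_
  · refine Set.Finite.biUnion (Finset.finite_toSet _) fun n _ => ?_
    exact (Finset.finite_toSet _).image _
  · rintro ⟨n, k⟩ ⟨hk, hle⟩
    simp only at hk hle
    have hn0 : (0:ℝ) ≤ n := Nat.cast_nonneg n
    have hJp := hJpos n hn0 k hk
    have hnN : n < N := by
      by_contra! h
      obtain ⟨⟨h1, h2⟩, h3⟩ := hN n h
      have hn' : (0:ℝ) < n := by exact_mod_cast h3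
      have hs0 : 0 < √(n:ℝ) := Real.sqrt_pos.mpr hn'
      have hlip := besselJ_lip n (n * α) (J n k) (by positivity) hJp
      rw [hJzero n hn0 k hk, sub_zero] at hlip
      have hd : |n * α - J n k| * (n * α) ≤ M := by
        refine le_trans ?_ hle
        rw [show (J n k)^2 - α^2*(n:ℝ)^2 = -((n * α - J n k) * (n * α + J n k)) by ring, abs_neg,
          abs_mul]
        gcongr
        rw [abs_of_pos (by positivity)]
        linarith
      have h4 : δ * (√n * α) ≤ M := by
        calc δ * (√n * α) ≤ (√n * |besselJ n (n * α)|) * (√n * α) := by gcongr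
          _ = |besselJ n (n * α)| * ((√n * √n) * α) := by ring
          _ = |besselJ n (n * α)| * (n * α) := by rw [Real.mul_self_sqrt hn0]
          _ ≤ |n * α - J n k| * (n * α) := by gcongr
          _ ≤ M := hd
      rw [div_lt_iff₀ (by positivity)] at h2
      nlinarith
    have hkK : k < K n := by
      by_contra! h
      have h1 := hK n k h
      have h2 : (J n k)^2 ≤ M + α^2 * (n:ℝ)^2 := by
        have := (abs_le.mp hle).2
        linarith
      have h3 := Real.le_sqrt_of_sq_le h2
      linarith
    simp only [mem_iUnion]
    exact ⟨n, by simpa using hnN, k, by simpa using hkK, rfl⟩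

theorem stmt_14 (α : ℝ) (hα : 1 < α)
    (p q : ℕ) (hp : 0 < p) (hq : 0 < q) (hcop : Nat.Coprime p q)
    (hpq : sigmaF α = (p:ℝ)/q)
    (hcond : ¬(4 ∣ p) ∨ 2 ∣ q)
    (J : ℝ → ℕ → ℝ)
    (hJpos : ∀ ν : ℝ, 0 ≤ ν → ∀ k : ℕ, 1 ≤ k → 0 < J ν k)
    (hJmono : ∀ ν : ℝ, 0 ≤ ν → ∀ k l : ℕ, 1 ≤ k → k < l → J ν k < J ν l)
    (hJzero : ∀ ν : ℝ, 0 ≤ ν → ∀ k : ℕ, 1 ≤ k → besselJ ν (J ν k) = 0)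
    (hJall : ∀ ν : ℝ, 0 ≤ ν → ∀ z : ℝ, 0 < z → besselJ ν z = 0 →
      ∃ k : ℕ, 1 ≤ k ∧ J ν k = z)
    : (∀ Λ : ℝ, ¬ AccPt Λ (Filter.principal
        {y : ℝ | ∃ ℓ k : ℕ, 1 ≤ k ∧ y = (J ℓ k)^2 - α^2*(ℓ:ℝ)^2})) ∧
      ∀ Λ : ℝ, {z : ℕ × ℕ | 1 ≤ z.2 ∧ (J z.1 z.2)^2 - α^2*(z.1:ℝ)^2 = Λ}.Finite := by
  have hfin := fin_bdd α hα p q hp hq hcop hpq hcond J hJpos hJmono hJzero hJall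
  constructor
  · intro Λ hacc
    have hM : 0 < |Λ| + 1 := by positivity
    have hF := (hfin (|Λ| + 1) hM).image (fun z : ℕ × ℕ => (J z.1 z.2)^2 - α^2*(z.1:ℝ)^2)
    rw [accPt_iff_nhds] at hacc
    have hopen : (((fun z : ℕ × ℕ => (J z.1 z.2)^2 - α^2*(z.1:ℝ)^2) ''
        {z : ℕ × ℕ | 1 ≤ z.2 ∧ |(J z.1 z.2)^2 - α^2*(z.1:ℝ)^2| ≤ |Λ| + 1}) \ {Λ})ᶜ ∈ nhds Λ := by
      refine (hF.subset sdiff_subset).isClosed.isOpen_compl.mem_nhds ?_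
      simp
    obtain ⟨y, ⟨⟨hy1, hy2⟩, ℓ, k, hk, hy⟩, hne⟩ := hacc _
      (inter_mem hopen (Metric.ball_mem_nhds Λ one_pos))
    apply hy1
    refine ⟨⟨(ℓ, k), ⟨hk, ?_⟩, hy.symm⟩, hne⟩
    simp only
    rw [← hy]
    rw [Metric.mem_ball, Real.dist_eq] at hy2
    have := abs_sub_abs_le_abs_sub y Λ
    linarith
  · intro Λ
    refine (hfin (|Λ| + 1) (by positivity)).subset ?_
    rintro z ⟨hk, hz⟩
    refine ⟨hk, ?_⟩
    rw [hz]
    linarith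
end
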